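/- Let p be a prime and θ as below. Let R = { (a,b,c,x) ∈ ℚ_p⁴ : min{v_p(a), v_p(b), v_p(c)} > v_p(ac − b²) and v_p(a + bx) < v_p(b + cx) } (so in particular ac − b² ≠ 0 and a + bx ≠ 0 on R). There exists T ∈ ℝ such that for all ν₁, ν₂ ∈ ℂ with Re(ν₂) > T and Re(ν₁ − ν₂) > T, the function (a,b,c,x) ↦ |a + bx|^{−1−ν₁+ν₂} · |ac − b²|^{−1−ν₂} · θ(−x − c) is absolutely integrable on R and ∫_R |a + bx|^{−1−ν₁+ν₂} |ac − b²|^{−1−ν₂} θ(−x − c) da db dc dx = −(1 − p⁻¹)·p^{−2−ν₁−ν₂} − (1 − p⁻¹)·p^{−2−2ν₁} − (1 − p⁻¹)·p^{−2−2ν₁−ν₂} + p^{−4−3ν₁−ν₂}. -/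

import Mathlib

open MeasureTheory
open scoped ENNReal NNReal Pointwise

section PadicNorm

variable {p : ℕ} [Fact p.Prime]

lemma padic_addValuation_lt_iff (x y : ℚ_[p]) :
    Padic.addValuation x < Padic.addValuation y ↔ ‖y‖ < ‖x‖ := by
  rcases eq_or_ne x 0 with rfl | hx
  · simp
  rcases eq_or_ne y 0 with rfl | hy
  · simp [Padic.addValuation.apply hx, hx]
  · rw [Padic.addValuation.apply hx, Padic.addValuation.apply hy,
      Padic.norm_eq_zpow_neg_valuation hx, Padic.norm_eq_zpow_neg_valuation hy,
      zpow_lt_zpow_iff_right₀ (by exact_mod_cast (Fact.out : p.Prime).one_lt)]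
    simp

lemma one_lt_prime_cast (p : ℕ) [Fact p.Prime] : (1 : ℝ) < p := by
  exact_mod_cast (Fact.out : p.Prime).one_lt

lemma prime_cast_pos (p : ℕ) [Fact p.Prime] : (0 : ℝ) < p := by
  linarith [one_lt_prime_cast p]

lemma padic_one_lt_norm_iff (x : ℚ_[p]) : 1 < ‖x‖ ↔ (p : ℝ) ≤ ‖x‖ := by
  refine ⟨fun h => ?_, fun h => (one_lt_prime_cast p).trans_le h⟩
  have hx : x ≠ 0 := by rintro rfl; norm_num at h
  rw [Padic.norm_eq_zpow_neg_valuation hx] at h ⊢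
  have : (0 : ℤ) < -x.valuation := by
    rw [← zpow_zero (p : ℝ)] at h
    exact (zpow_lt_zpow_iff_right₀ (one_lt_prime_cast p)).1 h
  calc (p : ℝ) = (p : ℝ) ^ (1 : ℤ) := by simp
    _ ≤ _ := zpow_le_zpow_right₀ (one_lt_prime_cast p).le (by omega)

lemma padic_norm_lt_one_iff (x : ℚ_[p]) : ‖x‖ < 1 ↔ ‖x‖ ≤ (p : ℝ)⁻¹ := by
  rcases eq_or_ne x 0 with rfl | hx
  · simp
  · have := padic_one_lt_norm_iff x⁻¹
    rw [norm_inv, one_lt_inv₀ (norm_pos_iff.2 hx)] at this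
    rw [this, le_inv_comm₀ (prime_cast_pos p) (norm_pos_iff.2 hx)]

lemma padic_norm_lt_prime_iff (x : ℚ_[p]) : ‖x‖ < p ↔ ‖x‖ ≤ 1 := by
  rw [← not_le, ← padic_one_lt_norm_iff, not_lt]

end PadicNorm

section PadicHaar

variable {p : ℕ} [Fact p.Prime] [MeasurableSpace ℚ_[p]] [BorelSpace ℚ_[p]] (μ : Measure ℚ_[p])

lemma padic_isAddHaar (hμ_inv : ∀ a : ℚ_[p], μ.map (a + ·) = μ)
    (hμ_norm : μ {x : ℚ_[p] | ‖x‖ ≤ 1} = 1) : μ.IsAddHaarMeasure := by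
  have : μ.IsAddLeftInvariant := ⟨hμ_inv⟩
  have hb : {x : ℚ_[p] | ‖x‖ ≤ 1} = Metric.closedBall 0 1 := by ext; simp
  rw [hb] at hμ_norm
  refine Measure.isAddHaarMeasure_of_isCompact_nonempty_interior μ (Metric.closedBall 0 1)
    (isCompact_closedBall _ _) ⟨0, ?_⟩ (by simp [hμ_norm]) (by simp [hμ_norm])
  exact interior_mono Metric.ball_subset_closedBall
    (by rw [Metric.isOpen_ball.interior_eq]; simp)

variable [μ.IsAddHaarMeasure]

lemma padic_prime_mul_measure_ball (hμ : μ {x : ℚ_[p] | ‖x‖ ≤ 1} = 1) :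
    (p : ℝ≥0∞) * μ {x : ℚ_[p] | ‖x‖ < 1} = 1 := by
  have hm (n : ℕ) : (fun x : ℚ_[p] => -(n : ℚ_[p]) + x) ⁻¹' {x : ℚ_[p] | ‖x‖ < 1} =
      {x : ℚ_[p] | ‖-(n : ℚ_[p]) + x‖ < 1} := by ext; simp
  have key (n : ℕ) (x : ℤ_[p]) : ‖-(n : ℚ_[p]) + x‖ < 1 ↔
      x - n ∈ IsLocalRing.maximalIdeal ℤ_[p] := by
    rw [IsLocalRing.mem_maximalIdeal, PadicInt.mem_nonunits, PadicInt.norm_def]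
    push_cast
    rw [neg_add_eq_sub]
  have hle (n : ℕ) (x : ℚ_[p]) (h : ‖-(n : ℚ_[p]) + x‖ < 1) : ‖x‖ ≤ 1 := by
    have : x = n + (-n + x) := by ring
    rw [this]
    exact (Padic.nonarchimedean _ _).trans
      (max_le (by exact_mod_cast Padic.norm_int_le_one n) h.le)
  have hU : {x : ℚ_[p] | ‖x‖ ≤ 1} =
      ⋃ n ∈ Finset.range p, {x : ℚ_[p] | ‖-(n : ℚ_[p]) + x‖ < 1} := by
    ext x
    simp only [Set.mem_ofPred_eq, Set.mem_iUnion, Finset.mem_range, exists_prop]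
    constructor
    · intro hx
      obtain ⟨n, ⟨hn, h⟩, -⟩ := PadicInt.existsUnique_mem_range (⟨x, hx⟩ : ℤ_[p])
      exact ⟨n, hn, (key n ⟨x, hx⟩).2 h⟩
    · rintro ⟨n, hn, h⟩
      exact hle n x h
  rw [← hμ, hU, measure_biUnion_finset]
  · simp_rw [← hm, measure_preimage_add]
    simp
  · intro i hi j hj hij
    rw [Function.onFun, Set.disjoint_left]
    intro x hx hy
    have h1 := hle i x hx
    have := PadicInt.existsUnique_mem_range (⟨x, h1⟩ : ℤ_[p])
    exact hij (this.unique ⟨by simpa using hi, (key i ⟨x, h1⟩).1 hx⟩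
      ⟨by simpa using hj, (key j ⟨x, h1⟩).1 hy⟩)
  · intro i hi
    exact measurableSet_lt (by fun_prop) (by fun_prop)

lemma padic_distribHaarChar (hμ : μ {x : ℚ_[p] | ‖x‖ ≤ 1} = 1) (u : ℚ_[p]ˣ) :
    distribHaarChar ℚ_[p] u = ‖(u : ℚ_[p])‖₊ := by
  have hd (v : ℚ_[p]ˣ) : (distribHaarChar ℚ_[p] v : ℝ≥0∞) =
      μ {x : ℚ_[p] | ‖x‖ ≤ ‖(v : ℚ_[p])‖} := by
    have h := distribHaarChar_mul μ v {x : ℚ_[p] | ‖x‖ ≤ 1}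
    rw [hμ, mul_one] at h
    rw [h]
    congr 1
    ext x
    rw [Set.mem_smul_set_iff_inv_smul_mem]
    simp only [Set.mem_ofPred_eq, Units.smul_def, smul_eq_mul, norm_mul,
      Units.val_inv_eq_inv_val, norm_inv]
    rw [inv_mul_le_iff₀ (norm_pos_iff.2 v.ne_zero), mul_one]
  have hp0 : (p : ℚ_[p]) ≠ 0 := by exact_mod_cast (Fact.out : p.Prime).ne_zero
  have hpr : distribHaarChar ℚ_[p] (Units.mk0 (p : ℚ_[p]) hp0) = (p : ℝ≥0)⁻¹ := by
    have h1 := hd (Units.mk0 (p : ℚ_[p]) hp0)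
    have h2 := padic_prime_mul_measure_ball μ hμ
    simp_rw [padic_norm_lt_one_iff] at h2
    simp only [Units.val_mk0, Padic.norm_p] at h1
    rw [← h1] at h2
    have h3 : (p : ℝ≥0) * distribHaarChar ℚ_[p] (Units.mk0 (p : ℚ_[p]) hp0) = 1 := by
      exact_mod_cast h2
    exact eq_inv_of_mul_eq_one_right h3
  have hn : ‖(u : ℚ_[p])‖₊ = ((p : ℝ≥0)⁻¹) ^ (u : ℚ_[p]).valuation := by
    ext
    push_cast
    rw [Padic.norm_eq_zpow_neg_valuation u.ne_zero, inv_zpow, zpow_neg]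
  rw [hn, ← hpr, ← map_zpow]
  have : (distribHaarChar ℚ_[p] u : ℝ≥0∞) = distribHaarChar ℚ_[p]
      (Units.mk0 (p : ℚ_[p]) hp0 ^ (u : ℚ_[p]).valuation) := by
    rw [hd, hd]
    congr 3
    ext x
    rw [Padic.norm_eq_zpow_neg_valuation u.ne_zero]
    simp
  exact_mod_cast this

lemma padic_map_mul_left (hμ : μ {x : ℚ_[p] | ‖x‖ ≤ 1} = 1) {c : ℚ_[p]} (hc : c ≠ 0) :
    ‖c‖₊ • μ.map (c * ·) = μ := by
  ext s hs
  rw [Measure.smul_apply, Measure.map_apply (by fun_prop) hs]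
  have := distribHaarChar_mul μ (Units.mk0 c hc) ((c * ·) ⁻¹' s)
  rw [padic_distribHaarChar μ hμ, Units.val_mk0] at this
  change (‖c‖₊ : ℝ≥0∞) * _ = _
  rw [this]
  congr 1
  ext x
  rw [Set.mem_smul_set_iff_inv_smul_mem]
  simp [Units.smul_def, hc]

lemma padic_lintegral_mul_left (hμ : μ {x : ℚ_[p] | ‖x‖ ≤ 1} = 1) {c : ℚ_[p]} (hc : c ≠ 0)
    (g : ℚ_[p] → ℝ≥0∞) : ∫⁻ t, ‖c‖₊ * g (c * t) ∂μ = ∫⁻ t, g t ∂μ := by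
  conv_rhs => rw [← padic_map_mul_left μ hμ hc]
  have e : MeasurableEmbedding (c * · : ℚ_[p] → ℚ_[p]) :=
    (Homeomorph.mulLeft₀ c hc).measurableEmbedding
  rw [lintegral_smul_measure, e.lintegral_map, lintegral_const_mul']
  · rfl
  · simp

lemma padic_measure_norm_le (hμ : μ {x : ℚ_[p] | ‖x‖ ≤ 1} = 1) {c : ℚ_[p]} (hc : c ≠ 0) :
    μ {x : ℚ_[p] | ‖x‖ ≤ ‖c‖} = ‖c‖₊ := by
  conv_lhs => rw [← padic_map_mul_left μ hμ hc]
  rw [Measure.smul_apply, Measure.map_apply (by fun_prop)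
    (measurableSet_le (by fun_prop) (by fun_prop))]
  have : (c * ·) ⁻¹' {x : ℚ_[p] | ‖x‖ ≤ ‖c‖} = {x : ℚ_[p] | ‖x‖ ≤ 1} := by
    ext x
    simp only [Set.mem_preimage, Set.mem_ofPred_eq, norm_mul]
    rw [mul_le_iff_le_one_right (norm_pos_iff.2 hc)]
  rw [this, hμ]
  change (‖c‖₊ : ℝ≥0∞) * 1 = _
  simp

end PadicHaar

section AdditiveCharacter

/-- A continuous unitary character of `ℚ_[p]` that is trivial on `ℤ_[p]` but not on
`p⁻¹ ℤ_[p]`. -/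
structure IsUnramifiedCharacter {p : ℕ} [Fact p.Prime] (θ : ℚ_[p] → ℂ) : Prop where
  cont : Continuous θ
  add : ∀ a b : ℚ_[p], θ (a + b) = θ a * θ b
  unit : ∀ a : ℚ_[p], ‖θ a‖ = 1
  triv : ∀ a : ℚ_[p], ‖a‖ ≤ 1 → θ a = 1
  nontriv : ∃ a : ℚ_[p], ‖a‖ ≤ (p : ℝ) ∧ θ a ≠ 1

lemma integral_eq_zero_of_twist {X : Type*} [MeasurableSpace X] {κ : Measure X} (e : X ≃ᵐ X)
    (he : MeasurePreserving e κ κ) {F : X → ℂ} {ζ : ℂ} (hζ : ζ ≠ 1)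
    (h : ∀ r, F (e r) = ζ * F r) : ∫ r, F r ∂κ = 0 := by
  have h1 : ∫ r, F (e r) ∂κ = ∫ r, F r ∂κ := he.integral_comp' F
  simp_rw [h, integral_const_mul] at h1
  have h2 : (ζ - 1) * ∫ r, F r ∂κ = 0 := by rw [sub_mul, h1]; ring
  exact (mul_eq_zero.1 h2).resolve_left (sub_ne_zero.2 hζ)

variable {p : ℕ} [Fact p.Prime] {θ : ℚ_[p] → ℂ}

lemma IsUnramifiedCharacter.exists_ne_one (hθ : IsUnramifiedCharacter θ) {c d : ℚ_[p]}
    (h : 1 < ‖c * d‖) : ∃ k : ℚ_[p], ‖k‖ ≤ ‖d‖ ∧ θ (c * k) ≠ 1 := by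
  obtain ⟨a, ha, ha'⟩ := hθ.nontriv
  have hc : c ≠ 0 := by rintro rfl; norm_num at h
  refine ⟨a / c, ?_, by rwa [mul_div_cancel₀ _ hc]⟩
  rw [norm_div, div_le_iff₀ (norm_pos_iff.2 hc), ← norm_mul, mul_comm d]
  exact ha.trans ((padic_one_lt_norm_iff _).1 h)

lemma padic_norm_add_eq_left {x y : ℚ_[p]} (h : ‖y‖ < ‖x‖) : ‖x + y‖ = ‖x‖ :=
  (Padic.add_eq_max_of_ne h.ne').trans (max_eq_left h.le)

lemma padic_norm_add_le_iff {x k : ℚ_[p]} {r : ℝ} (h : ‖k‖ ≤ r) : ‖x + k‖ ≤ r ↔ ‖x‖ ≤ r := by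
  refine ⟨fun hx => ?_, fun hx => (Padic.nonarchimedean _ _).trans (max_le hx h)⟩
  have : x = (x + k) + -k := by ring
  rw [this]
  exact (Padic.nonarchimedean _ _).trans (max_le hx (by rwa [norm_neg]))

lemma padic_norm_inv_prime : ‖(p : ℚ_[p])⁻¹‖ = p := by simp

lemma padic_prime_inv_ne_zero : (p : ℚ_[p])⁻¹ ≠ 0 := by
  simpa using (Fact.out : p.Prime).ne_zero

lemma padic_sphere_eq_diff : {t : ℚ_[p] | ‖t‖ = p} = {t | ‖t‖ ≤ p} \ {t | ‖t‖ ≤ 1} := by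
  ext t
  simp only [Set.mem_ofPred_eq, Set.mem_sdiff, not_le]
  rw [padic_one_lt_norm_iff]
  exact ⟨fun h => ⟨h.le, h.ge⟩, fun h => le_antisymm h.1 h.2⟩

variable [MeasurableSpace ℚ_[p]] [BorelSpace ℚ_[p]] {μ : Measure ℚ_[p]} [μ.IsAddHaarMeasure]

lemma IsUnramifiedCharacter.setIntegral_norm_le_eq_zero (hθ : IsUnramifiedCharacter θ)
    {c d : ℚ_[p]} (h : 1 < ‖c * d‖) : ∫ t in {t : ℚ_[p] | ‖t‖ ≤ ‖d‖}, θ (c * t) ∂μ = 0 := by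
  obtain ⟨k, hk, hk'⟩ := hθ.exists_ne_one h
  rw [← integral_indicator (measurableSet_le (by fun_prop) (by fun_prop))]
  refine integral_eq_zero_of_twist (MeasurableEquiv.addRight k)
    (measurePreserving_add_right μ k) hk' fun t => ?_
  simp only [MeasurableEquiv.coe_addRight, Set.indicator_apply, Set.mem_ofPred_eq,
    padic_norm_add_le_iff hk, mul_add, hθ.add]
  split_ifs <;> ring

lemma IsUnramifiedCharacter.setIntegral_norm_le (hθ : IsUnramifiedCharacter θ)
    (hμ : μ {x : ℚ_[p] | ‖x‖ ≤ 1} = 1) {c d : ℚ_[p]} (hd : d ≠ 0) (h : ‖c * d‖ ≤ 1) :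
    ∫ t in {t : ℚ_[p] | ‖t‖ ≤ ‖d‖}, θ (c * t) ∂μ = ‖d‖ := by
  have : ∀ t ∈ {t : ℚ_[p] | ‖t‖ ≤ ‖d‖}, θ (c * t) = 1 := by
    intro t ht
    refine hθ.triv _ (le_trans ?_ h)
    rw [norm_mul, norm_mul]
    exact mul_le_mul_of_nonneg_left ht (norm_nonneg _)
  rw [setIntegral_congr_fun (measurableSet_le (by fun_prop) (by fun_prop)) this]
  simp [Measure.real, padic_measure_norm_le μ hμ hd]

lemma padic_measureReal_norm_le (hμ : μ {x : ℚ_[p] | ‖x‖ ≤ 1} = 1) {d : ℚ_[p]} (hd : d ≠ 0) :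
    μ.real {x : ℚ_[p] | ‖x‖ ≤ ‖d‖} = ‖d‖ := by
  simp [Measure.real, padic_measure_norm_le μ hμ hd]

lemma IsUnramifiedCharacter.integrableOn_norm_le (hθ : IsUnramifiedCharacter θ) (c : ℚ_[p])
    (r : ℝ) : IntegrableOn (fun t => θ (c * t)) {t : ℚ_[p] | ‖t‖ ≤ r} μ := by
  have : {t : ℚ_[p] | ‖t‖ ≤ r} = Metric.closedBall 0 r := by ext; simp
  rw [this]
  have := hθ.cont
  exact (Continuous.continuousOn (by fun_prop)).integrableOn_compact (isCompact_closedBall _ _)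

lemma IsUnramifiedCharacter.setIntegral_sphere (hθ : IsUnramifiedCharacter θ)
    (hμ : μ {x : ℚ_[p] | ‖x‖ ≤ 1} = 1) {c : ℚ_[p]} (hc : ‖c‖ = 1) :
    ∫ t in {t : ℚ_[p] | ‖t‖ = p}, θ (c * t) ∂μ = -1 := by
  rw [padic_sphere_eq_diff, setIntegral_sdiff (measurableSet_le (by fun_prop) (by fun_prop))
    (hθ.integrableOn_norm_le _ _)]
  · have h1 := hθ.setIntegral_norm_le_eq_zero (μ := μ) (c := c) (d := (p : ℚ_[p])⁻¹)
      (by rw [norm_mul, padic_norm_inv_prime, hc, one_mul]; exact one_lt_prime_cast p)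
    have h2 := hθ.setIntegral_norm_le hμ (c := c) (d := 1) one_ne_zero (by simp [hc])
    rw [padic_norm_inv_prime] at h1
    rw [norm_one] at h2
    rw [h1, h2]
    simp
  · intro t ht
    exact le_trans ht (one_lt_prime_cast p).le

lemma IsUnramifiedCharacter.setIntegral_one_lt (hθ : IsUnramifiedCharacter θ)
    (hμ : μ {x : ℚ_[p] | ‖x‖ ≤ 1} = 1) {c : ℚ_[p]} (hc : ‖c‖ = 1) (ψ : ℝ → ℂ)
    (hψ : IntegrableOn (fun t : ℚ_[p] => ψ ‖t‖ * θ (c * t)) {t | 1 < ‖t‖} μ) :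
    ∫ t in {t : ℚ_[p] | 1 < ‖t‖}, ψ ‖t‖ * θ (c * t) ∂μ = -ψ p := by
  have hs : {t : ℚ_[p] | 1 < ‖t‖} = {t | ‖t‖ = p} ∪ {t | (p : ℝ) < ‖t‖} := by
    ext t
    simp only [Set.mem_ofPred_eq, Set.mem_union, padic_one_lt_norm_iff, le_iff_eq_or_lt, eq_comm]
  have hd : Disjoint {t : ℚ_[p] | ‖t‖ = p} {t | (p : ℝ) < ‖t‖} := by
    rw [Set.disjoint_left]
    intro t ht ht'
    exact absurd ht (ne_of_gt ht')
  have hm : MeasurableSet {t : ℚ_[p] | (p : ℝ) < ‖t‖} :=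
    measurableSet_lt (by fun_prop) (by fun_prop)
  rw [hs] at hψ ⊢
  rw [setIntegral_union hd hm (hψ.mono_set Set.subset_union_left)
    (hψ.mono_set Set.subset_union_right)]
  have h1 : ∫ t in {t : ℚ_[p] | ‖t‖ = p}, ψ ‖t‖ * θ (c * t) ∂μ = -ψ p := by
    have : ∀ t ∈ {t : ℚ_[p] | ‖t‖ = p}, ψ ‖t‖ * θ (c * t) = ψ p * θ (c * t) := by
      intro t ht
      rw [show ‖t‖ = p from ht]
    rw [setIntegral_congr_fun (measurableSet_eq_fun (by fun_prop) (by fun_prop)) this,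
      integral_const_mul, hθ.setIntegral_sphere hμ hc]
    ring
  have h2 : ∫ t in {t : ℚ_[p] | (p : ℝ) < ‖t‖}, ψ ‖t‖ * θ (c * t) ∂μ = 0 := by
    obtain ⟨k, hk, hk'⟩ := hθ.exists_ne_one (c := c) (d := (p : ℚ_[p])⁻¹)
      (by rw [norm_mul, padic_norm_inv_prime, hc, one_mul]; exact one_lt_prime_cast p)
    rw [padic_norm_inv_prime] at hk
    rw [← integral_indicator hm]
    refine integral_eq_zero_of_twist (MeasurableEquiv.addRight k)
      (measurePreserving_add_right μ k) hk' fun t => ?_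
    simp only [MeasurableEquiv.coe_addRight, Set.indicator_apply, Set.mem_ofPred_eq,
      ← not_le, padic_norm_add_le_iff hk, mul_add, hθ.add]
    split_ifs with h
    · ring
    · rw [padic_norm_add_eq_left (hk.trans_lt (not_le.1 h))]
      ring
  rw [h1, h2, add_zero]

lemma padic_integrableOn_rpow (hμ : μ {x : ℚ_[p] | ‖x‖ ≤ 1} = 1) {s : ℝ} (hs : s < -1) :
    IntegrableOn (fun t : ℚ_[p] => ‖t‖ ^ s) {t | 1 < ‖t‖} μ := by
  have hp := one_lt_prime_cast p
  have hm : Measurable (fun t : ℚ_[p] => ‖t‖ ^ s) := by fun_prop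
  refine ⟨hm.aestronglyMeasurable, ?_⟩
  have hU : {t : ℚ_[p] | 1 < ‖t‖} ⊆ ⋃ n : ℕ, {t : ℚ_[p] | ‖t‖ = (p : ℝ) ^ (n + 1)} := by
    intro t ht
    have ht0 : t ≠ 0 := by rintro rfl; norm_num at ht
    rw [Set.mem_ofPred_eq, Padic.norm_eq_zpow_neg_valuation ht0] at ht
    have h0 : (0 : ℤ) < -t.valuation := by
      rw [← zpow_zero (p : ℝ)] at ht
      exact (zpow_lt_zpow_iff_right₀ hp).1 ht
    refine Set.mem_iUnion.2 ⟨(-t.valuation - 1).toNat, ?_⟩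
    rw [Set.mem_ofPred_eq, Padic.norm_eq_zpow_neg_valuation ht0, ← zpow_natCast]
    congr 1
    push_cast
    omega
  refine lt_of_le_of_lt ((lintegral_mono_set hU).trans (lintegral_iUnion_le _ _)) ?_
  have hb (n : ℕ) : ∫⁻ t in {t : ℚ_[p] | ‖t‖ = (p : ℝ) ^ (n + 1)}, ‖‖t‖ ^ s‖ₑ ∂μ ≤
      ENNReal.ofReal (((p : ℝ) ^ (1 + s)) ^ (n + 1)) := by
    have hn : ‖((p : ℚ_[p])⁻¹) ^ (n + 1)‖ = (p : ℝ) ^ (n + 1) := by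
      rw [norm_pow, padic_norm_inv_prime]
    have hc : ∀ t ∈ {t : ℚ_[p] | ‖t‖ = (p : ℝ) ^ (n + 1)},
        ‖‖t‖ ^ s‖ₑ = ENNReal.ofReal (((p : ℝ) ^ (n + 1)) ^ s) := by
      intro t ht
      rw [show ‖t‖ = _ from ht, Real.enorm_of_nonneg (by positivity)]
    rw [setLIntegral_congr_fun (measurableSet_eq_fun (by fun_prop) (by fun_prop)) hc,
      setLIntegral_const]
    have hle : μ {t : ℚ_[p] | ‖t‖ = (p : ℝ) ^ (n + 1)} ≤ ENNReal.ofReal ((p : ℝ) ^ (n + 1)) := by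
      refine (measure_mono (t := {t : ℚ_[p] | ‖t‖ ≤ ‖((p : ℚ_[p])⁻¹) ^ (n + 1)‖}) ?_).trans ?_
      · intro t ht
        rw [Set.mem_ofPred_eq, hn]
        exact le_of_eq ht
      · rw [padic_measure_norm_le μ hμ (pow_ne_zero _ padic_prime_inv_ne_zero), ← hn,
          ofReal_norm]
        exact le_rfl
    refine (mul_le_mul_right hle _).trans (le_of_eq ?_)
    rw [← ENNReal.ofReal_mul (by positivity)]
    congr 1
    rw [← Real.rpow_natCast, ← Real.rpow_natCast, ← Real.rpow_mul (by positivity),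
      ← Real.rpow_add (by positivity), ← Real.rpow_mul (by positivity)]
    congr 1
    ring
  refine (ENNReal.tsum_le_tsum hb).trans_lt ?_
  have hr : (p : ℝ) ^ (1 + s) < 1 := Real.rpow_lt_one_of_one_lt_of_neg hp (by linarith)
  rw [← ENNReal.ofReal_tsum_of_nonneg (fun n => by positivity)]
  · exact ENNReal.ofReal_lt_top
  · exact (summable_nat_add_iff 1).2 (summable_geometric_of_lt_one (by positivity) hr)

end AdditiveCharacter

section ChangeOfVariables

lemma measurePreserving_withDensity_of_lintegral {X Y : Type*} [MeasurableSpace X]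
    [MeasurableSpace Y] {κ : Measure X} {ν : Measure Y} {Φ : X → Y} {J : X → ℝ≥0}
    (hΦ : Measurable Φ) (hJ : Measurable J)
    (h : ∀ g : Y → ℝ≥0∞, Measurable g → ∫⁻ r, J r * g (Φ r) ∂κ = ∫⁻ q, g q ∂ν) :
    MeasurePreserving Φ (κ.withDensity fun r => (J r : ℝ≥0∞)) ν := by
  refine ⟨hΦ, Measure.ext_of_lintegral _ fun g hg => ?_⟩
  rw [lintegral_map hg hΦ, lintegral_withDensity_eq_lintegral_mul _ (by fun_prop) (by fun_prop)]
  exact h g hg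

lemma MeasureTheory.MeasurePreserving.integrable_iff_of_density {X Y : Type*} [MeasurableSpace X]
    [MeasurableSpace Y] {κ : Measure X} {ν : Measure Y} {Φ : X → Y} {J : X → ℝ≥0}
    (hΦ : MeasurePreserving Φ (κ.withDensity fun r => (J r : ℝ≥0∞)) ν) (hJ : Measurable J)
    {f : Y → ℂ} (hf : Measurable f) {E : X → ℂ} (hE : ∀ r, (J r : ℂ) * f (Φ r) = E r) :
    Integrable f ν ↔ Integrable E κ := by
  rw [← hΦ.integrable_comp hf.aestronglyMeasurable,
    integrable_withDensity_iff_integrable_smul hJ]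
  refine iff_of_eq (congrArg (Integrable · κ) (funext fun r => ?_))
  rw [← hE, NNReal.smul_def, Complex.real_smul]
  rfl

lemma MeasureTheory.MeasurePreserving.integral_eq_of_density {X Y : Type*} [MeasurableSpace X]
    [MeasurableSpace Y] {κ : Measure X} {ν : Measure Y} {Φ : X → Y} {J : X → ℝ≥0}
    (hΦ : MeasurePreserving Φ (κ.withDensity fun r => (J r : ℝ≥0∞)) ν) (hJ : Measurable J)
    {f : Y → ℂ} (hf : Measurable f) {E : X → ℂ} (hE : ∀ r, (J r : ℂ) * f (Φ r) = E r) :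
    ∫ q, f q ∂ν = ∫ r, E r ∂κ := by
  rw [← hΦ.map_eq, integral_map hΦ.measurable.aemeasurable hf.aestronglyMeasurable,
    integral_withDensity_eq_integral_smul hJ]
  refine integral_congr_ae (Filter.Eventually.of_forall fun r => ?_)
  simp only [← hE, NNReal.smul_def, Complex.real_smul]

variable {Q : Type*} [MeasurableSpace Q] {μ : Measure Q} [SFinite μ]
  {G : (Q × Q) × (Q × Q) → ℝ≥0∞}

lemma lintegral_prod_four_left (hG : Measurable G) :
    ∫⁻ r, G r ∂((μ.prod μ).prod (μ.prod μ)) =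
      ∫⁻ x, ∫⁻ c, ∫⁻ b, ∫⁻ a, G ((a, b), (c, x)) ∂μ ∂μ ∂μ ∂μ := by
  rw [lintegral_prod_symm' _ hG, lintegral_prod_symm' _ (by fun_prop)]
  refine lintegral_congr fun x => lintegral_congr fun c => ?_
  rw [lintegral_prod_symm' _ (by fun_prop)]

lemma lintegral_prod_four_middle (hG : Measurable G) :
    ∫⁻ r, G r ∂((μ.prod μ).prod (μ.prod μ)) =
      ∫⁻ x, ∫⁻ a, ∫⁻ b, ∫⁻ c, G ((a, b), (c, x)) ∂μ ∂μ ∂μ ∂μ := by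
  rw [lintegral_prod_symm' _ hG, lintegral_prod_symm' _ (by fun_prop)]
  refine lintegral_congr fun x => ?_
  rw [lintegral_lintegral_swap (by fun_prop), lintegral_prod _ (by fun_prop)]

lemma lintegral_prod_four_middle' (hG : Measurable G) :
    ∫⁻ r, G r ∂((μ.prod μ).prod (μ.prod μ)) =
      ∫⁻ x, ∫⁻ b, ∫⁻ a, ∫⁻ c, G ((a, b), (c, x)) ∂μ ∂μ ∂μ ∂μ := by
  rw [lintegral_prod_four_middle hG]
  refine lintegral_congr fun x => ?_
  rw [lintegral_lintegral_swap (by fun_prop)]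

end ChangeOfVariables

section PadicChangeOfVariables

variable {p : ℕ} [Fact p.Prime] [MeasurableSpace ℚ_[p]] [BorelSpace ℚ_[p]] (μ : Measure ℚ_[p])
  [μ.IsAddHaarMeasure]

lemma padic_ae_ne_zero : ∀ᵐ t ∂μ, t ≠ 0 := by
  rw [ae_iff]
  simp

lemma padic_measurePreserving_shear :
    MeasurePreserving (fun r : (ℚ_[p] × ℚ_[p]) × (ℚ_[p] × ℚ_[p]) =>
      ((r.1.1 - 2 * r.1.2 * r.2.2 + r.2.1 * r.2.2 ^ 2, r.1.2 - r.2.1 * r.2.2), (r.2.1, r.2.2)))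
      (((μ.prod μ).prod (μ.prod μ)).withDensity fun _ => ((1 : ℝ≥0) : ℝ≥0∞))
      ((μ.prod μ).prod (μ.prod μ)) := by
  refine measurePreserving_withDensity_of_lintegral (by fun_prop) (by fun_prop) fun g hg => ?_
  rw [lintegral_prod_four_left (by fun_prop), lintegral_prod_four_left hg]
  refine lintegral_congr fun x => lintegral_congr fun c => ?_
  simp only [ENNReal.coe_one, one_mul]
  refine Eq.trans ?_ (lintegral_add_right_eq_self _ (-(c * x)))
  refine lintegral_congr fun b => ?_
  refine Eq.trans ?_ (lintegral_add_right_eq_self _ (-2 * b * x + c * x ^ 2))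
  refine lintegral_congr fun a => ?_
  congr 1
  simp only [Prod.mk.injEq, and_true]
  exact ⟨by ring, by ring⟩

lemma padic_measurePreserving_square (hμ : μ {x : ℚ_[p] | ‖x‖ ≤ 1} = 1) :
    MeasurePreserving (fun r : (ℚ_[p] × ℚ_[p]) × (ℚ_[p] × ℚ_[p]) =>
      ((r.1.1, r.1.1 * r.1.2), (r.2.1 + r.1.1 * r.1.2 ^ 2, r.2.2)))
      (((μ.prod μ).prod (μ.prod μ)).withDensity fun r => (‖r.1.1‖₊ : ℝ≥0∞))
      ((μ.prod μ).prod (μ.prod μ)) := by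
  refine measurePreserving_withDensity_of_lintegral (by fun_prop) (by fun_prop) fun g hg => ?_
  rw [lintegral_prod_four_middle (by fun_prop), lintegral_prod_four_middle hg]
  refine lintegral_congr fun x => lintegral_congr_ae ?_
  filter_upwards [padic_ae_ne_zero μ] with a ha
  refine Eq.trans ?_ (padic_lintegral_mul_left μ hμ ha _)
  refine lintegral_congr fun b => ?_
  rw [lintegral_const_mul' _ _ (by simp),
    ← lintegral_add_right_eq_self (fun c => g ((a, a * b), c, x)) (a * b ^ 2)]

lemma padic_measurePreserving_rescale (hμ : μ {x : ℚ_[p] | ‖x‖ ≤ 1} = 1) :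
    MeasurePreserving (fun r : (ℚ_[p] × ℚ_[p]) × (ℚ_[p] × ℚ_[p]) =>
      ((r.2.2 ^ 2 * r.1.1, r.2.2⁻¹ * r.1.2), (r.2.1, r.2.2)))
      (((μ.prod μ).prod (μ.prod μ)).withDensity fun r => (‖r.2.2‖₊ : ℝ≥0∞))
      ((μ.prod μ).prod (μ.prod μ)) := by
  have hinv : Measurable (fun x : ℚ_[p] => x⁻¹) := measurable_inv
  refine measurePreserving_withDensity_of_lintegral (by fun_prop) (by fun_prop) fun g hg => ?_
  rw [lintegral_prod_four_left (by fun_prop), lintegral_prod_four_left hg]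
  refine lintegral_congr_ae ?_
  filter_upwards [padic_ae_ne_zero μ] with x hx
  refine lintegral_congr fun c => ?_
  refine Eq.trans ?_ (padic_lintegral_mul_left μ hμ (inv_ne_zero hx) _)
  refine lintegral_congr fun b => ?_
  rw [← lintegral_const_mul' _ _ (by simp)]
  refine Eq.trans ?_ (padic_lintegral_mul_left μ hμ (pow_ne_zero 2 hx) _)
  refine lintegral_congr fun a => ?_
  rw [← mul_assoc, ← ENNReal.coe_mul]
  congr 2
  simp only [nnnorm_inv, nnnorm_pow]
  have : ‖x‖₊ ≠ 0 := by simpa using hx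
  field_simp

lemma padic_measurePreserving_scale (hμ : μ {x : ℚ_[p] | ‖x‖ ≤ 1} = 1) :
    MeasurePreserving (fun r : (ℚ_[p] × ℚ_[p]) × (ℚ_[p] × ℚ_[p]) =>
      ((r.1.2 * r.1.1, r.1.2), (r.1.2 * r.2.1, r.2.2)))
      (((μ.prod μ).prod (μ.prod μ)).withDensity fun r => ((‖r.1.2‖₊ ^ 2 : ℝ≥0) : ℝ≥0∞))
      ((μ.prod μ).prod (μ.prod μ)) := by
  refine measurePreserving_withDensity_of_lintegral (by fun_prop) (by fun_prop) fun g hg => ?_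
  rw [lintegral_prod_four_middle' (by fun_prop), lintegral_prod_four_middle' hg]
  refine lintegral_congr fun x => lintegral_congr_ae ?_
  filter_upwards [padic_ae_ne_zero μ] with b hb
  refine Eq.trans ?_ (padic_lintegral_mul_left μ hμ hb _)
  refine lintegral_congr fun a => ?_
  rw [← lintegral_const_mul' _ _ (by simp)]
  refine Eq.trans ?_ (padic_lintegral_mul_left μ hμ hb _)
  refine lintegral_congr fun c => ?_
  rw [← mul_assoc, ← ENNReal.coe_mul, sq]

end PadicChangeOfVariables

section NormPower

variable {p : ℕ} [Fact p.Prime]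

/-- The complex power `‖x‖ ^ s` of the norm of a `p`-adic number. -/
noncomputable def normPow (x : ℚ_[p]) (s : ℂ) : ℂ := (‖x‖ : ℂ) ^ s

lemma normPow_mul (x y : ℚ_[p]) (s : ℂ) : normPow (x * y) s = normPow x s * normPow y s := by
  simp only [normPow, norm_mul, Complex.ofReal_mul]
  exact Complex.mul_cpow_ofReal_nonneg (norm_nonneg _) (norm_nonneg _) _

lemma normPow_add {x : ℚ_[p]} (hx : x ≠ 0) (s t : ℂ) :
    normPow x (s + t) = normPow x s * normPow x t :=
  Complex.cpow_add _ _ (by simpa using hx)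

lemma normPow_one (x : ℚ_[p]) : normPow x 1 = ‖x‖ := by simp [normPow]

lemma normPow_congr {x y : ℚ_[p]} (h : ‖x‖ = ‖y‖) (s : ℂ) : normPow x s = normPow y s := by
  simp only [normPow, h]

lemma norm_normPow {x : ℚ_[p]} (hx : x ≠ 0) (s : ℂ) : ‖normPow x s‖ = ‖x‖ ^ s.re :=
  Complex.norm_cpow_eq_rpow_re_of_pos (norm_pos_iff.2 hx) s

lemma normPow_eq_one {x : ℚ_[p]} (h : ‖x‖ = 1) (s : ℂ) : normPow x s = 1 := by
  simp [normPow, h]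

lemma ne_zero_of_one_lt_norm {x : ℚ_[p]} (h : 1 < ‖x‖) : x ≠ 0 := by
  rintro rfl
  norm_num at h

lemma measurable_normPow [MeasurableSpace ℚ_[p]] [BorelSpace ℚ_[p]] (s : ℂ) :
    Measurable fun x : ℚ_[p] => normPow x s := by
  unfold normPow
  fun_prop

lemma Measurable.normPow {X : Type*} [MeasurableSpace X] [MeasurableSpace ℚ_[p]]
    [BorelSpace ℚ_[p]] {f : X → ℚ_[p]} (hf : Measurable f) (s : ℂ) :
    Measurable fun r => normPow (f r) s :=
  (measurable_normPow s).comp hf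

end NormPower

section Domains

variable {p : ℕ} [Fact p.Prime]

/-- The entries of the symmetric matrix with entries `a`, `b`, `c` are all smaller than its
determinant. -/
def DetDominates (a b c : ℚ_[p]) : Prop :=
  ‖a‖ < ‖a * c - b ^ 2‖ ∧ ‖b‖ < ‖a * c - b ^ 2‖ ∧ ‖c‖ < ‖a * c - b ^ 2‖

lemma padic_norm_add_lt {x y : ℚ_[p]} {r : ℝ} (hx : ‖x‖ < r) (hy : ‖y‖ < r) : ‖x + y‖ < r :=
  (Padic.nonarchimedean _ _).trans_lt (max_lt hx hy)

lemma norm_det_of_scale {b τ κ : ℚ_[p]} (hτ : ‖τ‖ ≤ 1) (hκ : ‖κ‖ < 1) :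
    ‖b * τ * (b * κ) - b ^ 2‖ = ‖b‖ ^ 2 := by
  rw [show b * τ * (b * κ) - b ^ 2 = b ^ 2 * (-1 + τ * κ) by ring, norm_mul, norm_pow,
    padic_norm_add_eq_left, norm_neg, norm_one, mul_one]
  rw [norm_mul, norm_neg, norm_one]
  exact mul_lt_one_of_nonneg_of_lt_one_right hτ (norm_nonneg _) hκ

lemma norm_linear_of_scale {b τ x : ℚ_[p]} (hτ : ‖τ‖ ≤ 1) (hx : 1 < ‖x‖) :
    ‖b * τ + b * x‖ = ‖b * x‖ := by
  rw [show b * τ + b * x = b * (x + τ) by ring, norm_mul,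
    padic_norm_add_eq_left (hτ.trans_lt hx), norm_mul]

lemma scale_domain_iff {b τ κ x : ℚ_[p]} (hb : b ≠ 0) (hτ : ‖τ‖ ≤ 1) (hx : 1 < ‖x‖) :
    (DetDominates (b * τ) b (b * κ) ∧ ‖b + b * κ * x‖ < ‖b * τ + b * x‖) ↔
      1 < ‖b‖ ∧ ‖κ‖ < 1 := by
  have hb' : 0 < ‖b‖ := norm_pos_iff.2 hb
  have hκ : ‖b + b * κ * x‖ < ‖b * τ + b * x‖ ↔ ‖κ‖ < 1 := by
    rw [norm_linear_of_scale hτ hx, show b + b * κ * x = b * (1 + κ * x) by ring, norm_mul,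
      norm_mul, mul_lt_mul_iff_right₀ hb']
    constructor
    · intro h
      have h1 : ‖(1 + κ * x) + -1‖ < ‖x‖ := padic_norm_add_lt h (by simpa using hx)
      rw [show (1 + κ * x) + -1 = κ * x by ring, norm_mul] at h1
      exact (mul_lt_iff_lt_one_left (by linarith)).1 h1
    · intro h
      refine padic_norm_add_lt (by simpa using hx) ?_
      rw [norm_mul]
      exact (mul_lt_iff_lt_one_left (by linarith)).2 h
  rw [hκ]
  refine and_congr_left fun h => ?_
  rw [DetDominates, norm_det_of_scale hτ h, norm_mul, norm_mul]
  constructor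
  · rintro ⟨-, h2, -⟩
    nlinarith
  · intro h1
    have h2 : ‖b‖ < ‖b‖ ^ 2 := by nlinarith
    exact ⟨by nlinarith, h2, by nlinarith⟩

lemma shear_domain_iff {A B c x : ℚ_[p]} (hx : ‖x‖ ≤ 1) :
    (DetDominates (A - 2 * B * x + c * x ^ 2) (B - c * x) c ∧
      ‖B - c * x + c * x‖ < ‖A - 2 * B * x + c * x ^ 2 + (B - c * x) * x‖) ↔
    (DetDominates A B c ∧ ‖B‖ < ‖A‖) := by
  have hdet (A B c x : ℚ_[p]) :
      (A - 2 * B * x + c * x ^ 2) * c - (B - c * x) ^ 2 = A * c - B ^ 2 := by ring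
  have key (A B c x : ℚ_[p]) (hx : ‖x‖ ≤ 1) (h : DetDominates A B c) :
      DetDominates (A - 2 * B * x + c * x ^ 2) (B - c * x) c := by
    have hm {y z : ℚ_[p]} {r : ℝ} (hy : ‖y‖ < r) (hz : ‖z‖ ≤ 1) : ‖y * z‖ < r := by
      rw [norm_mul]
      exact (mul_le_of_le_one_right (norm_nonneg _) hz).trans_lt hy
    obtain ⟨h1, h2, h3⟩ := h
    have h2x : ‖-2 * x‖ ≤ 1 := by
      rw [norm_mul]
      refine mul_le_one₀ ?_ (norm_nonneg _) hx
      exact_mod_cast Padic.norm_int_le_one (-2)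
    rw [DetDominates, hdet]
    refine ⟨?_, ?_, h3⟩
    · rw [show A - 2 * B * x + c * x ^ 2 = (A + B * (-2 * x)) + c * x ^ 2 by ring]
      refine padic_norm_add_lt (padic_norm_add_lt h1 (hm h2 h2x)) (hm h3 ?_)
      rw [norm_pow]
      exact pow_le_one₀ (norm_nonneg _) hx
    · rw [sub_eq_add_neg]
      refine padic_norm_add_lt h2 ?_
      rw [norm_neg]
      exact hm h3 hx
  refine and_congr ⟨fun h => ?_, key A B c x hx⟩ ?_
  · have := key _ _ _ (-x) (by rwa [norm_neg]) h
    convert this using 1 <;> ring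
  · rw [show B - c * x + c * x = B by ring,
      show A - 2 * B * x + c * x ^ 2 + (B - c * x) * x = A + -(B * x) by ring]
    have hBx : ‖-(B * x)‖ ≤ ‖B‖ := by
      rw [norm_neg, norm_mul]
      exact mul_le_of_le_one_right (norm_nonneg _) hx
    constructor
    · intro h
      by_contra! h'
      exact absurd ((Padic.nonarchimedean _ _).trans (max_le h' hBx)) (not_le.2 h)
    · intro h
      rwa [padic_norm_add_eq_left (hBx.trans_lt h)]

lemma norm_linear_of_shear {A B c x : ℚ_[p]} (hx : ‖x‖ ≤ 1) (h : ‖B‖ < ‖A‖) :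
    ‖A - 2 * B * x + c * x ^ 2 + (B - c * x) * x‖ = ‖A‖ := by
  rw [show A - 2 * B * x + c * x ^ 2 + (B - c * x) * x = A + -(B * x) by ring]
  refine padic_norm_add_eq_left (lt_of_le_of_lt ?_ h)
  rw [norm_neg, norm_mul]
  exact mul_le_of_le_one_right (norm_nonneg _) hx

lemma det_of_square (a β h : ℚ_[p]) : a * (h + a * β ^ 2) - (a * β) ^ 2 = a * h := by ring

lemma detDominates_square_iff {a β h : ℚ_[p]} (ha : a ≠ 0) (hβ : ‖β‖ < 1) :
    DetDominates a (a * β) (h + a * β ^ 2) ↔ 1 < ‖h‖ ∧ 1 < ‖a‖ := by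
  have ha' : 0 < ‖a‖ := norm_pos_iff.2 ha
  have hβ2 : ‖a * β ^ 2‖ ≤ ‖a‖ := by
    rw [norm_mul, norm_pow]
    exact mul_le_of_le_one_right ha'.le (pow_le_one₀ (norm_nonneg _) hβ.le)
  rw [DetDominates, det_of_square, norm_mul a h]
  constructor
  · rintro ⟨h1, -, h3⟩
    have hh : 1 < ‖h‖ := (lt_mul_iff_one_lt_right ha').1 h1
    refine ⟨hh, ?_⟩
    by_contra! h'
    rw [padic_norm_add_eq_left (hβ2.trans_lt (h'.trans_lt hh))] at h3
    nlinarith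
  · rintro ⟨hh, h1⟩
    have h2 : ‖a‖ < ‖a‖ * ‖h‖ := by nlinarith
    refine ⟨h2, ?_, padic_norm_add_lt (by nlinarith) (hβ2.trans_lt h2)⟩
    rw [norm_mul]
    nlinarith [norm_nonneg β]

lemma norm_linear_lt_iff {a β h x : ℚ_[p]} (hβ : ‖β‖ < 1) :
    ‖a * β + (h + a * β ^ 2) * x‖ < ‖a + a * β * x‖ ↔ ‖h * x‖ < ‖a * (1 + β * x)‖ := by
  rw [show a + a * β * x = a * (1 + β * x) by ring,
    show a * β + (h + a * β ^ 2) * x = h * x + a * (1 + β * x) * β by ring]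
  set y := a * (1 + β * x)
  have hle : ‖y * β‖ ≤ ‖y‖ := by
    rw [norm_mul]
    exact mul_le_of_le_one_right (norm_nonneg _) hβ.le
  have hy (h' : 0 < ‖y‖) : ‖y * β‖ < ‖y‖ := by
    rw [norm_mul]
    exact mul_lt_of_lt_one_right h' hβ
  constructor
  · intro h1
    have h2 : ‖(h * x + y * β) + -(y * β)‖ < ‖y‖ :=
      padic_norm_add_lt h1 (by rw [norm_neg]; exact hy ((norm_nonneg _).trans_lt h1))
    rwa [add_neg_cancel_right] at h2
  · intro h1
    exact padic_norm_add_lt h1 (hy ((norm_nonneg _).trans_lt h1))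

end Domains

section Pieces

lemma IntegrableOn.mul_prod {X Y : Type*} [MeasurableSpace X] [MeasurableSpace Y]
    {κ : Measure X} {ν : Measure Y} [SFinite κ] [SFinite ν] {L : Type*} [RCLike L]
    {f : X → L} {g : Y → L} {s : Set X} {t : Set Y} (hf : IntegrableOn f s κ)
    (hg : IntegrableOn g t ν) :
    IntegrableOn (fun z : X × Y => f z.1 * g z.2) (s ×ˢ t) (κ.prod ν) := by
  rw [IntegrableOn, ← Measure.prod_restrict]
  exact Integrable.mul_prod hf hg

lemma MeasureTheory.IntegrableOn.of_bound_subset {X : Type*} [MeasurableSpace X] {κ : Measure X}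
    {g : X → ℂ} {B : X → ℝ} {s t : Set X} (hB : IntegrableOn B t κ) (hs : MeasurableSet s)
    (hst : s ⊆ t) (hg : Measurable g) (h : ∀ r ∈ s, ‖g r‖ ≤ B r) : IntegrableOn g s κ :=
  Integrable.mono' (hB.mono_set hst) hg.aestronglyMeasurable (ae_restrict_of_forall_mem hs h)

lemma indicator_density {X Y : Type*} {Φ : X → Y} {J : X → ℝ≥0} {S : Set Y} {T : Set X}
    {F : Y → ℂ} {g : X → ℂ} (h₁ : ∀ r, J r ≠ 0 → (Φ r ∈ S ↔ r ∈ T)) (h₂ : ∀ r ∈ T, J r ≠ 0)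
    (h₃ : ∀ r ∈ T, (J r : ℂ) * F (Φ r) = g r) (r : X) :
    (J r : ℂ) * S.indicator F (Φ r) = T.indicator g r := by
  by_cases hT : r ∈ T
  · rw [Set.indicator_of_mem hT, Set.indicator_of_mem ((h₁ r (h₂ r hT)).2 hT), h₃ r hT]
  · rw [Set.indicator_of_notMem hT]
    by_cases hJ : J r = 0
    · simp [hJ]
    · rw [Set.indicator_of_notMem (fun h => hT ((h₁ r hJ).1 h)), mul_zero]

variable {p : ℕ} [Fact p.Prime]

/-- The integrand, in the variables `((a, b), (c, x))`. -/
noncomputable def binaryFormKernel (θ : ℚ_[p] → ℂ) (ν₁ ν₂ : ℂ)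
    (r : (ℚ_[p] × ℚ_[p]) × (ℚ_[p] × ℚ_[p])) : ℂ :=
  normPow (r.1.1 + r.1.2 * r.2.2) (-1 - ν₁ + ν₂) *
    normPow (r.1.1 * r.2.1 - r.1.2 ^ 2) (-1 - ν₂) * θ (-r.2.2 - r.2.1)

/-- The domain of integration, in the variables `((a, b), (c, x))`. -/
def binaryFormDomain (p : ℕ) [Fact p.Prime] : Set ((ℚ_[p] × ℚ_[p]) × (ℚ_[p] × ℚ_[p])) :=
  {r | DetDominates r.1.1 r.1.2 r.2.1 ∧ ‖r.1.2 + r.2.1 * r.2.2‖ < ‖r.1.1 + r.1.2 * r.2.2‖}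

variable {θ : ℚ_[p] → ℂ} {ν₁ ν₂ : ℂ}

/-- The part of the domain where `|x| > 1` and `|a| ≤ |b|`, after scaling by `b`. -/
def scaledDomain (p : ℕ) [Fact p.Prime] : Set ((ℚ_[p] × ℚ_[p]) × (ℚ_[p] × ℚ_[p])) :=
  ({τ | ‖τ‖ ≤ 1} ×ˢ {b | 1 < ‖b‖}) ×ˢ ({k | ‖k‖ < 1} ×ˢ {x | 1 < ‖x‖})

lemma scaledDomain_transfer (hθ : IsUnramifiedCharacter θ)
    (r : (ℚ_[p] × ℚ_[p]) × (ℚ_[p] × ℚ_[p])) :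
    ((‖r.1.2‖₊ ^ 2 : ℝ≥0) : ℂ) *
      (binaryFormDomain p ∩ {r | 1 < ‖r.2.2‖ ∧ ‖r.1.1‖ ≤ ‖r.1.2‖}).indicator
        (binaryFormKernel θ ν₁ ν₂) ((r.1.2 * r.1.1, r.1.2), (r.1.2 * r.2.1, r.2.2)) =
    (scaledDomain p).indicator (fun r => normPow r.1.2 (-1 - ν₁ - ν₂) *
      (θ (-r.1.2 * r.2.1) * (normPow r.2.2 (-1 - ν₁ + ν₂) * θ (-1 * r.2.2)))) r := by
  refine indicator_density (Φ := fun r : (ℚ_[p] × ℚ_[p]) × (ℚ_[p] × ℚ_[p]) =>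
      ((r.1.2 * r.1.1, r.1.2), (r.1.2 * r.2.1, r.2.2)))
      (J := fun r => ‖r.1.2‖₊ ^ 2) ?_ ?_ ?_ r
  · rintro ⟨⟨τ, b⟩, ⟨k, x⟩⟩ hJ
    have hb : b ≠ 0 := by simpa using hJ
    have hτ : ‖b * τ‖ ≤ ‖b‖ ↔ ‖τ‖ ≤ 1 := by
      rw [norm_mul]
      exact mul_le_iff_le_one_right (norm_pos_iff.2 hb)
    simp only [binaryFormDomain, scaledDomain, Set.mem_inter_iff, Set.mem_ofPred_eq, Set.mem_prod,
      hτ]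
    constructor
    · rintro ⟨h1, hx, h2⟩
      have := (scale_domain_iff hb h2 hx).1 h1
      exact ⟨⟨h2, this.1⟩, this.2, hx⟩
    · rintro ⟨⟨h2, h3⟩, h4, hx⟩
      exact ⟨(scale_domain_iff hb h2 hx).2 ⟨h3, h4⟩, hx, h2⟩
  · rintro ⟨⟨τ, b⟩, ⟨k, x⟩⟩ ⟨⟨-, hb⟩, -⟩
    simpa using ne_zero_of_one_lt_norm hb
  · rintro ⟨⟨τ, b⟩, ⟨k, x⟩⟩ ⟨⟨hτ, hb⟩, hk, hx⟩
    simp only [Set.mem_ofPred_eq] at hτ hb hk hx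
    have hb0 := ne_zero_of_one_lt_norm hb
    have hexp : normPow b (-1 - ν₁ - ν₂) = ‖b‖ * ‖b‖ * normPow b (-1 - ν₁ + ν₂) *
        normPow b (-1 - ν₂) * normPow b (-1 - ν₂) := by
      rw [← normPow_one, ← normPow_add hb0, ← normPow_add hb0, ← normPow_add hb0,
        ← normPow_add hb0]
      congr 1
      ring
    simp only [binaryFormKernel]
    rw [normPow_congr (norm_linear_of_scale hτ hx), normPow_mul,
      normPow_congr ((norm_det_of_scale hτ hk).trans (norm_pow b 2).symm), sq b, normPow_mul,
      hexp, show -x - b * k = -b * k + -1 * x by ring, hθ.add]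
    simp only [NNReal.coe_pow, coe_nnnorm, Complex.ofReal_pow]
    ring

/-- The part of the domain where `|x| ≤ 1`, after shearing by `x`. -/
def shearedDomain (p : ℕ) [Fact p.Prime] : Set ((ℚ_[p] × ℚ_[p]) × (ℚ_[p] × ℚ_[p])) :=
  {r | DetDominates r.1.1 r.1.2 r.2.1 ∧ ‖r.1.2‖ < ‖r.1.1‖ ∧ ‖r.2.2‖ ≤ 1}

/-- The integrand on `shearedDomain p`. -/
noncomputable def shearedKernel (θ : ℚ_[p] → ℂ) (ν₁ ν₂ : ℂ)
    (r : (ℚ_[p] × ℚ_[p]) × (ℚ_[p] × ℚ_[p])) : ℂ :=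
  normPow r.1.1 (-1 - ν₁ + ν₂) * normPow (r.1.1 * r.2.1 - r.1.2 ^ 2) (-1 - ν₂) * θ (-r.2.1)

lemma shearedDomain_transfer (hθ : IsUnramifiedCharacter θ)
    (r : (ℚ_[p] × ℚ_[p]) × (ℚ_[p] × ℚ_[p])) :
    ((1 : ℝ≥0) : ℂ) *
      (binaryFormDomain p ∩ {r | ‖r.2.2‖ ≤ 1}).indicator (binaryFormKernel θ ν₁ ν₂)
        ((r.1.1 - 2 * r.1.2 * r.2.2 + r.2.1 * r.2.2 ^ 2, r.1.2 - r.2.1 * r.2.2),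
          (r.2.1, r.2.2)) =
    (shearedDomain p).indicator (shearedKernel θ ν₁ ν₂) r := by
  refine indicator_density (Φ := fun r : (ℚ_[p] × ℚ_[p]) × (ℚ_[p] × ℚ_[p]) =>
    ((r.1.1 - 2 * r.1.2 * r.2.2 + r.2.1 * r.2.2 ^ 2, r.1.2 - r.2.1 * r.2.2), (r.2.1, r.2.2)))
      (J := fun _ => 1) ?_ ?_ ?_ r
  · rintro ⟨⟨a, b⟩, ⟨c, x⟩⟩ -
    simp only [binaryFormDomain, shearedDomain, Set.mem_inter_iff, Set.mem_ofPred_eq]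
    rw [← and_assoc]
    exact and_congr_left fun hx => shear_domain_iff hx
  · simp
  · rintro ⟨⟨a, b⟩, ⟨c, x⟩⟩ ⟨-, h, hx⟩
    simp only at h hx
    simp only [binaryFormKernel, shearedKernel]
    rw [normPow_congr (norm_linear_of_shear hx h), show -x - c = -x + -c by ring, hθ.add,
      hθ.triv (-x) (by rwa [norm_neg]),
      show (a - 2 * b * x + c * x ^ 2) * c - (b - c * x) ^ 2 = a * c - b ^ 2 by ring]
    simp

/-- The image of `shearedDomain p` after completing the square. -/
def diagonalDomain (p : ℕ) [Fact p.Prime] : Set ((ℚ_[p] × ℚ_[p]) × (ℚ_[p] × ℚ_[p])) :=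
  ({a | 1 < ‖a‖} ×ˢ {β | ‖β‖ < 1}) ×ˢ ({h | 1 < ‖h‖} ×ˢ {x | ‖x‖ ≤ 1})

lemma diagonalDomain_transfer (hθ : IsUnramifiedCharacter θ)
    (r : (ℚ_[p] × ℚ_[p]) × (ℚ_[p] × ℚ_[p])) :
    (‖r.1.1‖₊ : ℂ) * (shearedDomain p).indicator (shearedKernel θ ν₁ ν₂)
      ((r.1.1, r.1.1 * r.1.2), (r.2.1 + r.1.1 * r.1.2 ^ 2, r.2.2)) =
    (diagonalDomain p).indicator (fun r => normPow r.1.1 (-1 - ν₁) * θ (-r.1.2 ^ 2 * r.1.1) *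
      (normPow r.2.1 (-1 - ν₂) * θ (-1 * r.2.1) * 1)) r := by
  refine indicator_density (Φ := fun r : (ℚ_[p] × ℚ_[p]) × (ℚ_[p] × ℚ_[p]) =>
    ((r.1.1, r.1.1 * r.1.2), (r.2.1 + r.1.1 * r.1.2 ^ 2, r.2.2)))
      (J := fun r => ‖r.1.1‖₊) ?_ ?_ ?_ r
  · rintro ⟨⟨a, β⟩, ⟨h, x⟩⟩ hJ
    have ha : a ≠ 0 := by simpa using hJ
    have hβ : ‖a * β‖ < ‖a‖ ↔ ‖β‖ < 1 := by
      rw [norm_mul]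
      exact mul_lt_iff_lt_one_right (norm_pos_iff.2 ha)
    simp only [diagonalDomain, shearedDomain, Set.mem_ofPred_eq, Set.mem_prod, hβ]
    constructor
    · rintro ⟨h1, h2, hx⟩
      have := (detDominates_square_iff ha h2).1 h1
      exact ⟨⟨this.2, h2⟩, this.1, hx⟩
    · rintro ⟨⟨h2, h3⟩, h4, hx⟩
      exact ⟨(detDominates_square_iff ha h3).2 ⟨h4, h2⟩, h3, hx⟩
  · rintro ⟨⟨a, β⟩, ⟨h, x⟩⟩ ⟨⟨ha, -⟩, -⟩
    simpa using ne_zero_of_one_lt_norm ha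
  · rintro ⟨⟨a, β⟩, ⟨h, x⟩⟩ ⟨⟨ha, hβ⟩, hh, hx⟩
    have ha0 := ne_zero_of_one_lt_norm ha
    have hexp : normPow a (-1 - ν₁) = ‖a‖ * normPow a (-1 - ν₁ + ν₂) * normPow a (-1 - ν₂) := by
      rw [← normPow_one, ← normPow_add ha0, ← normPow_add ha0]
      congr 1
      ring
    simp only [shearedKernel]
    rw [det_of_square, normPow_mul,
      hexp,
      show -(h + a * β ^ 2) = -β ^ 2 * a + -1 * h by ring, hθ.add]
    simp only [coe_nnnorm]
    ring

/-- The part of the domain where `|x| > 1` and `|b| < |a|`, after completing the square. -/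
def squaredDomain (p : ℕ) [Fact p.Prime] : Set ((ℚ_[p] × ℚ_[p]) × (ℚ_[p] × ℚ_[p])) :=
  {r | 1 < ‖r.1.1‖ ∧ ‖r.1.2‖ < 1 ∧ 1 < ‖r.2.1‖ ∧ 1 < ‖r.2.2‖ ∧
    ‖r.2.1 * r.2.2‖ < ‖r.1.1 * (1 + r.1.2 * r.2.2)‖}

/-- The integrand on `squaredDomain p`. -/
noncomputable def squaredKernel (θ : ℚ_[p] → ℂ) (ν₁ ν₂ : ℂ)
    (r : (ℚ_[p] × ℚ_[p]) × (ℚ_[p] × ℚ_[p])) : ℂ :=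
  normPow r.1.1 (-1 - ν₁) * normPow (1 + r.1.2 * r.2.2) (-1 - ν₁ + ν₂) *
    normPow r.2.1 (-1 - ν₂) * (θ (-r.1.2 ^ 2 * r.1.1) * (θ (-1 * r.2.1) * θ (-1 * r.2.2)))

lemma squaredDomain_transfer (hθ : IsUnramifiedCharacter θ)
    (r : (ℚ_[p] × ℚ_[p]) × (ℚ_[p] × ℚ_[p])) :
    (‖r.1.1‖₊ : ℂ) * (binaryFormDomain p ∩ {r | 1 < ‖r.2.2‖ ∧ ‖r.1.2‖ < ‖r.1.1‖}).indicator
      (binaryFormKernel θ ν₁ ν₂)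
      ((r.1.1, r.1.1 * r.1.2), (r.2.1 + r.1.1 * r.1.2 ^ 2, r.2.2)) =
    (squaredDomain p).indicator (squaredKernel θ ν₁ ν₂) r := by
  refine indicator_density (Φ := fun r : (ℚ_[p] × ℚ_[p]) × (ℚ_[p] × ℚ_[p]) =>
    ((r.1.1, r.1.1 * r.1.2), (r.2.1 + r.1.1 * r.1.2 ^ 2, r.2.2)))
      (J := fun r => ‖r.1.1‖₊) ?_ ?_ ?_ r
  · rintro ⟨⟨a, β⟩, ⟨h, x⟩⟩ hJ
    have ha : a ≠ 0 := by simpa using hJ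
    have hβ : ‖a * β‖ < ‖a‖ ↔ ‖β‖ < 1 := by
      rw [norm_mul]
      exact mul_lt_iff_lt_one_right (norm_pos_iff.2 ha)
    simp only [binaryFormDomain, squaredDomain, Set.mem_inter_iff, Set.mem_ofPred_eq, hβ]
    constructor
    · rintro ⟨⟨h1, h3⟩, hx, h2⟩
      have := (detDominates_square_iff ha h2).1 h1
      exact ⟨this.2, h2, this.1, hx, (norm_linear_lt_iff h2).1 h3⟩
    · rintro ⟨h1, h2, h3, hx, h4⟩
      exact ⟨⟨(detDominates_square_iff ha h2).2 ⟨h3, h1⟩, (norm_linear_lt_iff h2).2 h4⟩, hx, h2⟩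
  · rintro ⟨⟨a, β⟩, ⟨h, x⟩⟩ ⟨ha, -⟩
    simpa using ne_zero_of_one_lt_norm ha
  · rintro ⟨⟨a, β⟩, ⟨h, x⟩⟩ ⟨ha, hβ, hh, hx, -⟩
    have ha0 := ne_zero_of_one_lt_norm ha
    have hexp : normPow a (-1 - ν₁) = ‖a‖ * normPow a (-1 - ν₁ + ν₂) * normPow a (-1 - ν₂) := by
      rw [← normPow_one, ← normPow_add ha0, ← normPow_add ha0]
      congr 1
      ring
    simp only [binaryFormKernel, squaredKernel]
    rw [det_of_square, normPow_mul, show a + a * β * x = a * (1 + β * x) by ring, normPow_mul,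
      hexp,
      show -x - (h + a * β ^ 2) = -β ^ 2 * a + (-1 * h + -1 * x) by ring, hθ.add, hθ.add]
    simp only [coe_nnnorm]
    ring

/-- The image of `squaredDomain p` after rescaling by `x`. -/
def rescaledDomain (p : ℕ) [Fact p.Prime] : Set ((ℚ_[p] × ℚ_[p]) × (ℚ_[p] × ℚ_[p])) :=
  {r | 1 < ‖r.2.1‖ ∧ 1 < ‖r.2.2‖ ∧ ‖r.1.2‖ < ‖r.2.2‖ ∧
    ‖r.2.1‖ < ‖r.1.1‖ * ‖1 + r.1.2‖ * ‖r.2.2‖}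

/-- The integrand on `rescaledDomain p`. -/
noncomputable def rescaledKernel (θ : ℚ_[p] → ℂ) (ν₁ ν₂ : ℂ)
    (r : (ℚ_[p] × ℚ_[p]) × (ℚ_[p] × ℚ_[p])) : ℂ :=
  normPow r.1.1 (-1 - ν₁) * normPow (1 + r.1.2) (-1 - ν₁ + ν₂) * θ (-r.1.2 ^ 2 * r.1.1) *
    (normPow r.2.1 (-1 - ν₂) * normPow r.2.2 (-1 - 2 * ν₁)) *
    (θ (-1 * r.2.1) * θ (-1 * r.2.2))

lemma rescaledDomain_transfer (r : (ℚ_[p] × ℚ_[p]) × (ℚ_[p] × ℚ_[p])) :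
    (‖r.2.2‖₊ : ℂ) * (squaredDomain p).indicator (squaredKernel θ ν₁ ν₂)
      ((r.2.2 ^ 2 * r.1.1, r.2.2⁻¹ * r.1.2), (r.2.1, r.2.2)) =
    (rescaledDomain p).indicator (rescaledKernel θ ν₁ ν₂) r := by
  refine indicator_density (Φ := fun r : (ℚ_[p] × ℚ_[p]) × (ℚ_[p] × ℚ_[p]) =>
    ((r.2.2 ^ 2 * r.1.1, r.2.2⁻¹ * r.1.2), (r.2.1, r.2.2)))
      (J := fun r => ‖r.2.2‖₊) ?_ ?_ ?_ r
  · rintro ⟨⟨α, ε⟩, ⟨h, x⟩⟩ hJ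
    have hx0 : x ≠ 0 := by simpa using hJ
    have hx0' : 0 < ‖x‖ := norm_pos_iff.2 hx0
    simp only [squaredDomain, rescaledDomain, Set.mem_ofPred_eq,
      show x⁻¹ * ε * x = ε by field_simp, norm_mul, norm_inv, norm_pow]
    have h1 : ‖x‖⁻¹ * ‖ε‖ < 1 ↔ ‖ε‖ < ‖x‖ := inv_mul_lt_one₀ hx0'
    have h2 : ‖h‖ * ‖x‖ < ‖x‖ ^ 2 * ‖α‖ * ‖1 + ε‖ ↔ ‖h‖ < ‖α‖ * ‖1 + ε‖ * ‖x‖ := by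
      rw [show ‖x‖ ^ 2 * ‖α‖ * ‖1 + ε‖ = (‖α‖ * ‖1 + ε‖ * ‖x‖) * ‖x‖ by ring]
      exact mul_lt_mul_iff_left₀ hx0'
    rw [h1, h2]
    constructor
    · rintro ⟨-, h2, h3, h4, h5⟩
      exact ⟨h3, h4, h2, h5⟩
    · rintro ⟨h3, h4, h2, h5⟩
      refine ⟨?_, h2, h3, h4, h5⟩
      have h6 : ‖1 + ε‖ < ‖x‖ := padic_norm_add_lt (by simpa using h4) h2
      have h7 : ‖α‖ * ‖1 + ε‖ * ‖x‖ ≤ ‖α‖ * ‖x‖ * ‖x‖ := by gcongr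
      calc 1 < ‖h‖ := h3
        _ < ‖α‖ * ‖x‖ * ‖x‖ := h5.trans_le h7
        _ = ‖x‖ ^ 2 * ‖α‖ := by ring
  · rintro ⟨⟨α, ε⟩, ⟨h, x⟩⟩ ⟨-, hx, -⟩
    simpa using ne_zero_of_one_lt_norm hx
  · rintro ⟨⟨α, ε⟩, ⟨h, x⟩⟩ ⟨hh, hx, -, -⟩
    have hx0 := ne_zero_of_one_lt_norm hx
    simp only [squaredKernel, rescaledKernel]
    rw [show x⁻¹ * ε * x = ε by field_simp, show -(x⁻¹ * ε) ^ 2 * (x ^ 2 * α) = -ε ^ 2 * α by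
      field_simp, normPow_mul, sq x, normPow_mul,
      show -1 - 2 * ν₁ = 1 + (-1 - ν₁) + (-1 - ν₁) by ring, normPow_add hx0, normPow_add hx0,
      normPow_one]
    simp only [coe_nnnorm]
    ring

lemma padic_integrableOn_one [MeasurableSpace ℚ_[p]] {μ : Measure ℚ_[p]}
    (hμ : μ {x : ℚ_[p] | ‖x‖ ≤ 1} = 1) {s : Set ℚ_[p]} (hs : s ⊆ {x | ‖x‖ ≤ 1}) :
    IntegrableOn (fun _ => (1 : ℝ)) s μ := by
  refine integrableOn_const (ne_top_of_le_ne_top ENNReal.one_ne_top ?_)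
  rw [← hμ]
  exact measure_mono hs

variable [MeasurableSpace ℚ_[p]] [BorelSpace ℚ_[p]] {μ : Measure ℚ_[p]} [μ.IsAddHaarMeasure]

lemma measurable_binaryFormKernel (hθ : IsUnramifiedCharacter θ) :
    Measurable (binaryFormKernel θ ν₁ ν₂) := by
  have := hθ.cont
  exact ((Measurable.normPow (by fun_prop) _).mul (Measurable.normPow (by fun_prop) _)).mul
    (this.measurable.comp (by fun_prop))

lemma measurableSet_detDominates {X : Type*} [MeasurableSpace X] {a b c : X → ℚ_[p]}
    (ha : Measurable a) (hb : Measurable b) (hc : Measurable c) :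
    MeasurableSet {r | DetDominates (a r) (b r) (c r)} := by
  have hd : Measurable fun r => ‖a r * c r - b r ^ 2‖ := by fun_prop
  exact (measurableSet_lt ha.norm hd).inter
    ((measurableSet_lt hb.norm hd).inter (measurableSet_lt hc.norm hd))

lemma measurableSet_binaryFormDomain : MeasurableSet (binaryFormDomain p) :=
  (measurableSet_detDominates (a := fun r : (ℚ_[p] × ℚ_[p]) × (ℚ_[p] × ℚ_[p]) => r.1.1)
    (b := fun r => r.1.2) (c := fun r => r.2.1) (by fun_prop) (by fun_prop) (by fun_prop)).inter
    (measurableSet_lt (f := fun r : (ℚ_[p] × ℚ_[p]) × (ℚ_[p] × ℚ_[p]) =>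
      ‖r.1.2 + r.2.1 * r.2.2‖) (g := fun r => ‖r.1.1 + r.1.2 * r.2.2‖)
      (by fun_prop) (by fun_prop))

lemma integrableOn_scaledDomain (hθ : IsUnramifiedCharacter θ)
    (hμ : μ {x : ℚ_[p] | ‖x‖ ≤ 1} = 1) (h₂ : 1 < ν₂.re) (h₁ : 1 < (ν₁ - ν₂).re) :
    IntegrableOn (fun r : (ℚ_[p] × ℚ_[p]) × (ℚ_[p] × ℚ_[p]) => normPow r.1.2 (-1 - ν₁ - ν₂) *
      (θ (-r.1.2 * r.2.1) * (normPow r.2.2 (-1 - ν₁ + ν₂) * θ (-1 * r.2.2)))) (scaledDomain p)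
      ((μ.prod μ).prod (μ.prod μ)) := by
  have hθm := hθ.cont.measurable
  simp only [Complex.sub_re] at h₁
  have hms (r : ℝ) : MeasurableSet {x : ℚ_[p] | r < ‖x‖} :=
    measurableSet_lt (by fun_prop) (by fun_prop)
  refine IntegrableOn.of_bound_subset (IntegrableOn.mul_prod (IntegrableOn.mul_prod
    (padic_integrableOn_one hμ subset_rfl)
    (padic_integrableOn_rpow hμ (s := (-1 - ν₁ - ν₂).re) ?_)) (IntegrableOn.mul_prod
    (padic_integrableOn_one hμ (s := {k | ‖k‖ < 1}) fun x hx => (show ‖x‖ < 1 from hx).le)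
    (padic_integrableOn_rpow hμ (s := (-1 - ν₁ + ν₂).re) ?_))) ?_ subset_rfl ?_ ?_
  · simp; linarith
  · simp; linarith
  · exact ((measurableSet_le (by fun_prop) (by fun_prop)).prod (hms 1)).prod
      ((measurableSet_lt (by fun_prop) (by fun_prop)).prod (hms 1))
  · exact (Measurable.normPow (by fun_prop) _).mul ((hθm.comp (by fun_prop)).mul
      ((Measurable.normPow (by fun_prop) _).mul (hθm.comp (by fun_prop))))
  · rintro ⟨⟨τ, b⟩, ⟨k, x⟩⟩ ⟨⟨-, hb⟩, -, hx⟩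
    simp only [norm_mul, hθ.unit, norm_normPow (ne_zero_of_one_lt_norm hb),
      norm_normPow (ne_zero_of_one_lt_norm hx)]
    simp

lemma integrableOn_diagonalDomain (hθ : IsUnramifiedCharacter θ)
    (hμ : μ {x : ℚ_[p] | ‖x‖ ≤ 1} = 1) (h₂ : 1 < ν₂.re) (h₁ : 1 < (ν₁ - ν₂).re) :
    IntegrableOn (fun r : (ℚ_[p] × ℚ_[p]) × (ℚ_[p] × ℚ_[p]) =>
      normPow r.1.1 (-1 - ν₁) * θ (-r.1.2 ^ 2 * r.1.1) *
      (normPow r.2.1 (-1 - ν₂) * θ (-1 * r.2.1) * 1)) (diagonalDomain p)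
      ((μ.prod μ).prod (μ.prod μ)) := by
  have hθm := hθ.cont.measurable
  simp only [Complex.sub_re] at h₁
  have hms (r : ℝ) : MeasurableSet {x : ℚ_[p] | r < ‖x‖} :=
    measurableSet_lt (by fun_prop) (by fun_prop)
  refine IntegrableOn.of_bound_subset (IntegrableOn.mul_prod (IntegrableOn.mul_prod
    (padic_integrableOn_rpow hμ (s := (-1 - ν₁).re) ?_)
    (padic_integrableOn_one hμ (s := {k | ‖k‖ < 1}) fun x hx => (show ‖x‖ < 1 from hx).le))
    (IntegrableOn.mul_prod
    (padic_integrableOn_rpow hμ (s := (-1 - ν₂).re) ?_)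
    (padic_integrableOn_one hμ subset_rfl))) ?_ subset_rfl ?_ ?_
  · simp; linarith
  · simp; linarith
  · exact ((hms 1).prod (measurableSet_lt (by fun_prop) (by fun_prop))).prod
      ((hms 1).prod (measurableSet_le (by fun_prop) (by fun_prop)))
  · exact ((Measurable.normPow (by fun_prop) _).mul (hθm.comp (by fun_prop))).mul
      (((Measurable.normPow (by fun_prop) _).mul (hθm.comp (by fun_prop))).mul (by fun_prop))
  · rintro ⟨⟨a, β⟩, ⟨h, x⟩⟩ ⟨⟨ha, -⟩, hh, -⟩
    simp only [norm_mul, hθ.unit, norm_normPow (ne_zero_of_one_lt_norm ha),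
      norm_normPow (ne_zero_of_one_lt_norm hh)]
    simp

lemma measurable_squaredKernel (hθ : IsUnramifiedCharacter θ) :
    Measurable (squaredKernel θ ν₁ ν₂) := by
  have hθm := hθ.cont.measurable
  exact (((Measurable.normPow (by fun_prop) _).mul (Measurable.normPow (by fun_prop) _)).mul
    (Measurable.normPow (by fun_prop) _)).mul ((hθm.comp (by fun_prop)).mul
      ((hθm.comp (by fun_prop)).mul (hθm.comp (by fun_prop))))

lemma measurableSet_squaredDomain : MeasurableSet (squaredDomain p) := by
  have h {f g : (ℚ_[p] × ℚ_[p]) × (ℚ_[p] × ℚ_[p]) → ℝ} (hf : Measurable f)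
    (hg : Measurable g) : MeasurableSet {r | f r < g r} := measurableSet_lt hf hg
  exact (h (f := fun _ => 1) (g := fun r => ‖r.1.1‖) (by fun_prop) (by fun_prop)).inter
    ((h (f := fun r => ‖r.1.2‖) (g := fun _ => 1) (by fun_prop) (by fun_prop)).inter
    ((h (f := fun _ => 1) (g := fun r => ‖r.2.1‖) (by fun_prop) (by fun_prop)).inter
    ((h (f := fun _ => 1) (g := fun r => ‖r.2.2‖) (by fun_prop) (by fun_prop)).inter
    (h (f := fun r => ‖r.2.1 * r.2.2‖) (g := fun r => ‖r.1.1 * (1 + r.1.2 * r.2.2)‖)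
      (by fun_prop) (by fun_prop)))))

lemma integrableOn_squaredDomain (hθ : IsUnramifiedCharacter θ)
    (hμ : μ {x : ℚ_[p] | ‖x‖ ≤ 1} = 1) (h₂ : 1 < ν₂.re) (h₁ : 1 < (ν₁ - ν₂).re) :
    IntegrableOn (squaredKernel θ ν₁ ν₂) (squaredDomain p) ((μ.prod μ).prod (μ.prod μ)) := by
  simp only [Complex.sub_re] at h₁
  refine IntegrableOn.of_bound_subset (t :=
    ({a | 1 < ‖a‖} ×ˢ {β | ‖β‖ < 1}) ×ˢ ({h | 1 < ‖h‖} ×ˢ {x | 1 < ‖x‖}))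
    (IntegrableOn.mul_prod (IntegrableOn.mul_prod
    (padic_integrableOn_rpow hμ (s := -ν₂.re) (by linarith))
    (padic_integrableOn_one hμ (s := {k | ‖k‖ < 1}) fun x hx => (show ‖x‖ < 1 from hx).le))
    (IntegrableOn.mul_prod
    (padic_integrableOn_rpow hμ (s := -2 - ν₁.re) (by linarith))
    (padic_integrableOn_rpow hμ (s := -(1 + ν₁.re - ν₂.re)) (by linarith))))
    measurableSet_squaredDomain ?_ (measurable_squaredKernel hθ) ?_
  · rintro ⟨⟨a, β⟩, ⟨h, x⟩⟩ ⟨h1, h2, h3, h4, -⟩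
    exact ⟨⟨h1, h2⟩, h3, h4⟩
  · rintro ⟨⟨a, β⟩, ⟨h, x⟩⟩ ⟨ha, hβ, hh, hx, hlt⟩
    simp only [norm_mul] at ha hβ hh hx hlt
    have hy0 : 1 + β * x ≠ 0 := by
      intro h0
      rw [h0, norm_zero, mul_zero] at hlt
      nlinarith
    have hy : 0 < ‖1 + β * x‖ := norm_pos_iff.2 hy0
    have ha' : 0 < ‖a‖ := by linarith
    have hh' : 0 < ‖h‖ := by linarith
    have hx' : 0 < ‖x‖ := by linarith
    simp only [squaredKernel, norm_mul, hθ.unit, norm_normPow (ne_zero_of_one_lt_norm ha),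
      norm_normPow (ne_zero_of_one_lt_norm hh), norm_normPow hy0]
    simp only [Complex.sub_re, Complex.add_re, Complex.neg_re, Complex.one_re, mul_one]
    have hm : ‖1 + β * x‖ ^ (-1 - ν₁.re + ν₂.re) ≤
        (‖h‖ * ‖x‖ / ‖a‖) ^ (-1 - ν₁.re + ν₂.re) := by
      refine Real.rpow_le_rpow_of_nonpos (by positivity) ?_ (by linarith)
      rw [div_le_iff₀ ha', mul_comm ‖1 + β * x‖]
      exact hlt.le
    rw [Real.div_rpow (by positivity) (by positivity), Real.mul_rpow (by positivity)
      (by positivity), div_eq_mul_inv, ← Real.rpow_neg ha'.le] at hm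
    calc ‖a‖ ^ (-1 - ν₁.re) * ‖1 + β * x‖ ^ (-1 - ν₁.re + ν₂.re) * ‖h‖ ^ (-1 - ν₂.re)
        ≤ ‖a‖ ^ (-1 - ν₁.re) * (‖h‖ ^ (-1 - ν₁.re + ν₂.re) * ‖x‖ ^ (-1 - ν₁.re + ν₂.re) *
          ‖a‖ ^ (-(-1 - ν₁.re + ν₂.re))) * ‖h‖ ^ (-1 - ν₂.re) := by gcongr
      _ = ‖a‖ ^ (-ν₂.re) * (‖h‖ ^ (-2 - ν₁.re) * ‖x‖ ^ (-(1 + ν₁.re - ν₂.re))) := by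
        have ea : ‖a‖ ^ (-1 - ν₁.re) * ‖a‖ ^ (-(-1 - ν₁.re + ν₂.re)) = ‖a‖ ^ (-ν₂.re) := by
          rw [← Real.rpow_add ha']
          congr 1
          ring
        have eh : ‖h‖ ^ (-1 - ν₁.re + ν₂.re) * ‖h‖ ^ (-1 - ν₂.re) = ‖h‖ ^ (-2 - ν₁.re) := by
          rw [← Real.rpow_add hh']
          congr 1
          ring
        rw [← ea, ← eh, show -(1 + ν₁.re - ν₂.re) = -1 - ν₁.re + ν₂.re by ring]
        ring

end Pieces

section NormAveraging

variable {p : ℕ} [Fact p.Prime] [MeasurableSpace ℚ_[p]] [BorelSpace ℚ_[p]] {μ : Measure ℚ_[p]}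
  [μ.IsAddHaarMeasure] {θ : ℚ_[p] → ℂ}

lemma IsUnramifiedCharacter.integral_norm_mul (hθ : IsUnramifiedCharacter θ)
    (hμ : μ {x : ℚ_[p] | ‖x‖ ≤ 1} = 1) {c : ℚ_[p]} (hc : ‖c‖ = 1) {ψ : ℝ → ℂ}
    (hψ₀ : ∀ u ≤ 1, ψ u = 0) (hψ : Integrable (fun t : ℚ_[p] => ψ ‖t‖ * θ (c * t)) μ) :
    ∫ t, ψ ‖t‖ * θ (c * t) ∂μ = -ψ p := by
  rw [← hθ.setIntegral_one_lt hμ hc ψ hψ.integrableOn,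
    setIntegral_eq_integral_of_forall_compl_eq_zero]
  intro t ht
  rw [hψ₀ _ (not_lt.1 ht), zero_mul]

variable {Z : Type*} [MeasurableSpace Z] {κ : Measure Z} [SFinite κ]

lemma IsUnramifiedCharacter.integral_prod_norm (hθ : IsUnramifiedCharacter θ)
    (hμ : μ {x : ℚ_[p] | ‖x‖ ≤ 1} = 1) {c : Z → ℚ_[p]} {W : Z → ℝ → ℂ}
    (hc : ∀ z u, W z u ≠ 0 → ‖c z‖ = 1) (hW₀ : ∀ z, ∀ u ≤ 1, W z u = 0)
    (hW : Integrable (fun r : Z × ℚ_[p] => W r.1 ‖r.2‖ * θ (c r.1 * r.2)) (κ.prod μ)) :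
    ∫ r, W r.1 ‖r.2‖ * θ (c r.1 * r.2) ∂(κ.prod μ) = -∫ z, W z p ∂κ := by
  rw [integral_prod _ hW, ← integral_neg]
  refine integral_congr_ae ?_
  filter_upwards [hW.prod_right_ae] with z hz
  by_cases h : ‖c z‖ = 1
  · exact hθ.integral_norm_mul hμ h (hW₀ z) hz
  · have h0 (u : ℝ) : W z u = 0 := by
      by_contra h'
      exact h (hc z u h')
    simp [h0]

lemma IsUnramifiedCharacter.exists_norm_eq_prime (hθ : IsUnramifiedCharacter θ)
    (hμ : μ {x : ℚ_[p] | ‖x‖ ≤ 1} = 1) {P : ℚ_[p] → Prop} (h : ∀ᵐ t ∂μ, P t) :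
    ∃ t : ℚ_[p], ‖t‖ = p ∧ P t := by
  by_contra! h'
  have h0 : μ {t : ℚ_[p] | ‖t‖ = p} = 0 :=
    measure_mono_null (fun t ht => h' t ht) (ae_iff.1 h)
  have h1 := hθ.setIntegral_sphere hμ (c := 1) norm_one
  rw [setIntegral_measure_zero _ h0] at h1
  norm_num at h1

lemma IsUnramifiedCharacter.integrable_of_prod_norm (hθ : IsUnramifiedCharacter θ)
    (hμ : μ {x : ℚ_[p] | ‖x‖ ≤ 1} = 1) {c : ℚ_[p]} {W : Z → ℝ → ℂ}
    (hW : Integrable (fun r : Z × ℚ_[p] => W r.1 ‖r.2‖ * θ (c * r.2)) (κ.prod μ)) :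
    Integrable (fun z => W z p) κ := by
  obtain ⟨t, ht, hi⟩ := hθ.exists_norm_eq_prime hμ hW.prod_left_ae
  have hne : θ (c * t) ≠ 0 := by
    rw [← norm_ne_zero_iff, hθ.unit]
    exact one_ne_zero
  simp only [ht] at hi
  exact (integrable_mul_const_iff hne.isUnit _).1 hi

lemma IsUnramifiedCharacter.integral_prod_norm_norm (hθ : IsUnramifiedCharacter θ)
    (hμ : μ {x : ℚ_[p] | ‖x‖ ≤ 1} = 1) {W : Z → ℝ → ℝ → ℂ}
    (hW₁ : ∀ z v, ∀ u ≤ 1, W z u v = 0) (hW₂ : ∀ z u, ∀ v ≤ 1, W z u v = 0)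
    (hW : Integrable (fun r : Z × (ℚ_[p] × ℚ_[p]) =>
      W r.1 ‖r.2.1‖ ‖r.2.2‖ * (θ (-1 * r.2.1) * θ (-1 * r.2.2))) (κ.prod (μ.prod μ))) :
    Integrable (fun z => W z p p) κ ∧
    ∫ r, W r.1 ‖r.2.1‖ ‖r.2.2‖ * (θ (-1 * r.2.1) * θ (-1 * r.2.2)) ∂(κ.prod (μ.prod μ)) =
      ∫ z, W z p p ∂κ := by
  have h1 : ‖(-1 : ℚ_[p])‖ = 1 := by simp
  have hA : Integrable (fun r : (Z × ℚ_[p]) × ℚ_[p] =>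
      W r.1.1 ‖r.1.2‖ ‖r.2‖ * θ (-1 * r.1.2) * θ (-1 * r.2)) ((κ.prod μ).prod μ) := by
    refine ((measurePreserving_prodAssoc κ μ μ).integrable_comp_of_integrable hW).congr
      (Filter.Eventually.of_forall fun r => ?_)
    exact (mul_assoc _ _ _).symm
  have hB : Integrable (fun r : Z × ℚ_[p] => W r.1 ‖r.2‖ p * θ (-1 * r.2)) (κ.prod μ) :=
    hθ.integrable_of_prod_norm hμ (c := -1) (κ := κ.prod μ)
      (W := fun r u => W r.1 ‖r.2‖ u * θ (-1 * r.2)) hA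
  refine ⟨hθ.integrable_of_prod_norm hμ (c := -1) (W := fun z u => W z u p) hB, ?_⟩
  have e3 := (measurePreserving_prodAssoc κ μ μ).integral_comp'
    (fun r : Z × (ℚ_[p] × ℚ_[p]) =>
      W r.1 ‖r.2.1‖ ‖r.2.2‖ * (θ (-1 * r.2.1) * θ (-1 * r.2.2)))
  have e1 : ∫ r : (Z × ℚ_[p]) × ℚ_[p],
      W r.1.1 ‖r.1.2‖ ‖r.2‖ * θ (-1 * r.1.2) * θ (-1 * r.2) ∂((κ.prod μ).prod μ) =
      -∫ r : Z × ℚ_[p], W r.1 ‖r.2‖ p * θ (-1 * r.2) ∂(κ.prod μ) :=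
    hθ.integral_prod_norm hμ (κ := κ.prod μ) (c := fun _ => -1)
      (W := fun r u => W r.1 ‖r.2‖ u * θ (-1 * r.2)) (fun _ _ _ => h1)
      (fun z u hu => by simp only [hW₂ _ _ _ hu, zero_mul]) hA
  have e2 : ∫ r : Z × ℚ_[p], W r.1 ‖r.2‖ p * θ (-1 * r.2) ∂(κ.prod μ) = -∫ z, W z p p ∂κ :=
    hθ.integral_prod_norm hμ (κ := κ) (c := fun _ => -1)
      (W := fun z u => W z u p) (fun _ _ _ => h1) (fun z u hu => hW₁ z _ u hu) hB
  rw [e2, neg_neg] at e1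
  rw [← e1, ← (measurePreserving_prodAssoc κ μ μ).integral_comp'
    (fun r : Z × (ℚ_[p] × ℚ_[p]) =>
      W r.1 ‖r.2.1‖ ‖r.2.2‖ * (θ (-1 * r.2.1) * θ (-1 * r.2.2)))]
  refine integral_congr_ae (Filter.Eventually.of_forall fun r => ?_)
  exact (mul_assoc _ _ _).symm

end NormAveraging

section Spheres

variable {p : ℕ} [Fact p.Prime]

lemma padic_norm_prime_mul (d : ℚ_[p]) : ‖(p : ℚ_[p]) * d‖ = (p : ℝ)⁻¹ * ‖d‖ := by simp

lemma padic_prime_ne_zero : (p : ℚ_[p]) ≠ 0 := by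
  simpa using (Fact.out : p.Prime).ne_zero

lemma padic_norm_lt_iff_le {t d : ℚ_[p]} (hd : d ≠ 0) :
    ‖t‖ < ‖d‖ ↔ ‖t‖ ≤ ‖(p : ℚ_[p]) * d‖ := by
  have hd' := norm_pos_iff.2 hd
  have := padic_norm_lt_one_iff (t / d)
  rwa [norm_div, div_lt_one hd', div_le_iff₀ hd', ← padic_norm_prime_mul] at this

variable [MeasurableSpace ℚ_[p]] [BorelSpace ℚ_[p]] {μ : Measure ℚ_[p]} [μ.IsAddHaarMeasure]

lemma padic_measurableSet_norm_le (r : ℝ) : MeasurableSet {t : ℚ_[p] | ‖t‖ ≤ r} :=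
  measurableSet_le (by fun_prop) (by fun_prop)

lemma padic_measurableSet_norm_lt (r : ℝ) : MeasurableSet {t : ℚ_[p] | ‖t‖ < r} :=
  measurableSet_lt (by fun_prop) (by fun_prop)

lemma padic_measurableSet_lt_norm (r : ℝ) : MeasurableSet {t : ℚ_[p] | r < ‖t‖} :=
  measurableSet_lt (by fun_prop) (by fun_prop)

lemma padic_measurableSet_norm_eq (r : ℝ) : MeasurableSet {t : ℚ_[p] | ‖t‖ = r} :=
  measurableSet_eq_fun (by fun_prop) (by fun_prop)

lemma padic_measureReal_norm_lt (hμ : μ {x : ℚ_[p] | ‖x‖ ≤ 1} = 1) {d : ℚ_[p]} (hd : d ≠ 0) :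
    μ.real {x : ℚ_[p] | ‖x‖ < ‖d‖} = (p : ℝ)⁻¹ * ‖d‖ := by
  simp only [padic_norm_lt_iff_le hd]
  rw [padic_measureReal_norm_le hμ (mul_ne_zero padic_prime_ne_zero hd), padic_norm_prime_mul]

lemma padic_measure_norm_le_ne_top (hμ : μ {x : ℚ_[p] | ‖x‖ ≤ 1} = 1) {d : ℚ_[p]} (hd : d ≠ 0) :
    μ {x : ℚ_[p] | ‖x‖ ≤ ‖d‖} ≠ ⊤ := by
  rw [padic_measure_norm_le μ hμ hd]
  exact ENNReal.coe_ne_top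

lemma padic_measureReal_norm_eq (hμ : μ {x : ℚ_[p] | ‖x‖ ≤ 1} = 1) {d : ℚ_[p]} (hd : d ≠ 0) :
    μ.real {x : ℚ_[p] | ‖x‖ = ‖d‖} = (1 - (p : ℝ)⁻¹) * ‖d‖ := by
  have hs : {x : ℚ_[p] | ‖x‖ = ‖d‖} = {x | ‖x‖ ≤ ‖d‖} \ {x | ‖x‖ < ‖d‖} := by
    ext x
    simp only [Set.mem_ofPred_eq, Set.mem_sdiff, not_lt]
    exact ⟨fun h => ⟨h.le, h.ge⟩, fun h => le_antisymm h.1 h.2⟩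
  rw [hs, measureReal_sdiff (s₁ := {x : ℚ_[p] | ‖x‖ ≤ ‖d‖}) (s₂ := {x | ‖x‖ < ‖d‖})
    (fun x (hx : ‖x‖ < ‖d‖) => hx.le) (padic_measurableSet_norm_lt _)
    (padic_measure_norm_le_ne_top hμ hd),
    padic_measureReal_norm_le hμ hd, padic_measureReal_norm_lt hμ hd]
  ring

lemma padic_measureReal_norm_eq_one_inter (hμ : μ {x : ℚ_[p] | ‖x‖ ≤ 1} = 1) :
    μ.real {x : ℚ_[p] | ‖x‖ = 1 ∧ ‖1 + x‖ = 1} = 1 - 2 * (p : ℝ)⁻¹ := by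
  have hs : {x : ℚ_[p] | ‖x‖ = 1 ∧ ‖1 + x‖ = 1} =
      {x | ‖x‖ = 1} \ ((1 + ·) ⁻¹' {x | ‖x‖ < 1}) := by
    ext x
    simp only [Set.mem_ofPred_eq, Set.mem_sdiff, not_lt, Set.mem_preimage]
    refine and_congr_right fun h => ⟨fun h' => h'.ge, fun h' => le_antisymm ?_ h'⟩
    exact (Padic.nonarchimedean _ _).trans (max_le norm_one.le h.le)
  have h1 := padic_measureReal_norm_eq hμ (d := 1) one_ne_zero
  have h2 := padic_measureReal_norm_lt hμ (d := 1) one_ne_zero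
  have h3 := padic_measure_norm_le_ne_top hμ (d := 1) one_ne_zero
  rw [norm_one] at h1 h2 h3
  have h4 : μ {x : ℚ_[p] | ‖x‖ = 1} ≠ ⊤ :=
    ne_top_of_le_ne_top h3 (measure_mono fun x (hx : ‖x‖ = 1) => hx.le)
  rw [hs, measureReal_sdiff (h₁ := h4), h1, measureReal_def, measure_preimage_add,
    ← measureReal_def, h2]
  · ring
  · intro x hx
    have : ‖-1 + (1 + x)‖ = ‖(-1 : ℚ_[p])‖ := padic_norm_add_eq_left (by simpa using hx)
    simpa using this
  · exact (padic_measurableSet_norm_lt _).preimage (by fun_prop)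

lemma padic_setIntegral_normPow_norm_eq (hμ : μ {x : ℚ_[p] | ‖x‖ ≤ 1} = 1) {d : ℚ_[p]}
    (hd : d ≠ 0) (s : ℂ) :
    ∫ x in {x : ℚ_[p] | ‖x‖ = ‖d‖}, normPow x s ∂μ =
      (1 - (p : ℂ)⁻¹) * normPow d (1 + s) := by
  rw [setIntegral_congr_fun (g := fun _ => normPow d s) (padic_measurableSet_norm_eq _)
    fun x hx => normPow_congr hx s, setIntegral_const, padic_measureReal_norm_eq hμ hd,
    normPow_add hd, normPow_one, Complex.real_smul]
  push_cast
  ring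

lemma IsUnramifiedCharacter.integrableOn_normPow_mul {θ : ℚ_[p] → ℂ}
    (hθ : IsUnramifiedCharacter θ) (hμ : μ {x : ℚ_[p] | ‖x‖ ≤ 1} = 1) {s : ℂ} (hs : s.re < -1)
    (c : ℚ_[p]) : IntegrableOn (fun x => normPow x s * θ (c * x)) {x : ℚ_[p] | 1 < ‖x‖} μ := by
  have hθm := hθ.cont.measurable
  refine IntegrableOn.of_bound_subset (padic_integrableOn_rpow hμ hs)
    (padic_measurableSet_lt_norm 1) subset_rfl
    ((measurable_normPow s).mul (hθm.comp (by fun_prop))) fun x hx => ?_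
  rw [norm_mul, hθ.unit, mul_one, norm_normPow (ne_zero_of_one_lt_norm hx)]

lemma IsUnramifiedCharacter.setIntegral_normPow_mul {θ : ℚ_[p] → ℂ}
    (hθ : IsUnramifiedCharacter θ) (hμ : μ {x : ℚ_[p] | ‖x‖ ≤ 1} = 1) {s : ℂ} (hs : s.re < -1)
    {c : ℚ_[p]} (hc : ‖c‖ = 1) :
    ∫ x in {x : ℚ_[p] | 1 < ‖x‖}, normPow x s * θ (c * x) ∂μ = -(p : ℂ) ^ s := by
  have := hθ.setIntegral_one_lt hμ hc (fun u => (u : ℂ) ^ s)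
    (hθ.integrableOn_normPow_mul hμ hs c)
  simpa only [normPow, Complex.ofReal_natCast] using this

end Spheres

section Evaluation

variable {p : ℕ} [Fact p.Prime] [MeasurableSpace ℚ_[p]] [BorelSpace ℚ_[p]] {μ : Measure ℚ_[p]}
  [μ.IsAddHaarMeasure] {θ : ℚ_[p] → ℂ} {ν₁ ν₂ : ℂ}

lemma IsUnramifiedCharacter.setIntegral_norm_lt_one (hθ : IsUnramifiedCharacter θ)
    (hμ : μ {x : ℚ_[p] | ‖x‖ ≤ 1} = 1) {b : ℚ_[p]} (hb : 1 < ‖b‖) :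
    ∫ k in {k : ℚ_[p] | ‖k‖ < 1}, θ (-b * k) ∂μ =
      {b : ℚ_[p] | ‖b‖ = p}.indicator (fun _ => (p : ℂ)⁻¹) b := by
  have hs : {k : ℚ_[p] | ‖k‖ < 1} = {k | ‖k‖ ≤ ‖(p : ℚ_[p])‖} := by
    ext k
    rw [Set.mem_ofPred_eq, Set.mem_ofPred_eq, padic_norm_lt_one_iff, Padic.norm_p]
  have hp := prime_cast_pos p
  have hn : ‖-b * (p : ℚ_[p])‖ = ‖b‖ / p := by
    rw [norm_mul, norm_neg, Padic.norm_p, div_eq_mul_inv]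
  rw [hs]
  by_cases h : ‖b‖ = p
  · rw [Set.indicator_of_mem (show b ∈ {b : ℚ_[p] | ‖b‖ = p} from h),
      hθ.setIntegral_norm_le hμ padic_prime_ne_zero]
    · simp
    · rw [hn, h, div_self hp.ne']
  · rw [Set.indicator_of_notMem (show b ∉ {b : ℚ_[p] | ‖b‖ = p} from h),
      hθ.setIntegral_norm_le_eq_zero]
    rw [hn, one_lt_div hp]
    exact lt_of_le_of_ne ((padic_one_lt_norm_iff b).1 hb) (Ne.symm h)

lemma setIntegral_scaledDomain (hθ : IsUnramifiedCharacter θ)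
    (hμ : μ {x : ℚ_[p] | ‖x‖ ≤ 1} = 1) (h₂ : 1 < ν₂.re) (h₁ : 1 < (ν₁ - ν₂).re) :
    ∫ r in scaledDomain p, normPow r.1.2 (-1 - ν₁ - ν₂) *
      (θ (-r.1.2 * r.2.1) * (normPow r.2.2 (-1 - ν₁ + ν₂) * θ (-1 * r.2.2)))
      ∂((μ.prod μ).prod (μ.prod μ)) =
    -((1 - (p : ℂ)⁻¹) * (p : ℂ) ^ (-1 - ν₁ - ν₂) * (p : ℂ) ^ (-1 - ν₁ + ν₂)) := by
  have hint := integrableOn_scaledDomain hθ hμ h₂ h₁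
  simp only [Complex.sub_re] at h₁
  rw [scaledDomain] at hint ⊢
  rw [setIntegral_prod _ hint]
  have hx : ∫ x in {x : ℚ_[p] | 1 < ‖x‖}, normPow x (-1 - ν₁ + ν₂) * θ (-1 * x) ∂μ =
      -(p : ℂ) ^ (-1 - ν₁ + ν₂) :=
    hθ.setIntegral_normPow_mul hμ (by simp; linarith) (by simp)
  have hinner : ∀ z ∈ {τ : ℚ_[p] | ‖τ‖ ≤ 1} ×ˢ {b : ℚ_[p] | 1 < ‖b‖},
      ∫ w in {k : ℚ_[p] | ‖k‖ < 1} ×ˢ {x : ℚ_[p] | 1 < ‖x‖}, normPow z.2 (-1 - ν₁ - ν₂) *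
        (θ (-z.2 * w.1) * (normPow w.2 (-1 - ν₁ + ν₂) * θ (-1 * w.2))) ∂(μ.prod μ) =
      1 * {b : ℚ_[p] | ‖b‖ = p}.indicator (fun b => normPow b (-1 - ν₁ - ν₂) * ((p : ℂ)⁻¹ *
        -(p : ℂ) ^ (-1 - ν₁ + ν₂))) z.2 := by
    rintro ⟨τ, b⟩ ⟨-, hb⟩
    rw [integral_const_mul, setIntegral_prod_mul (fun k => θ (-b * k))
      (fun x => normPow x (-1 - ν₁ + ν₂) * θ (-1 * x)), hx, hθ.setIntegral_norm_lt_one hμ hb,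
      one_mul]
    by_cases h : b ∈ {b : ℚ_[p] | ‖b‖ = p}
    · rw [Set.indicator_of_mem h, Set.indicator_of_mem h]
    · rw [Set.indicator_of_notMem h, Set.indicator_of_notMem h, zero_mul, mul_zero]
  rw [setIntegral_congr_fun ((padic_measurableSet_norm_le 1).prod (padic_measurableSet_lt_norm 1))
    hinner, setIntegral_prod_mul (fun _ : ℚ_[p] => (1 : ℂ)),
    setIntegral_indicator (padic_measurableSet_norm_eq _), integral_mul_const]
  have hs : {b : ℚ_[p] | 1 < ‖b‖} ∩ {b | ‖b‖ = p} = {b | ‖b‖ = ‖(p : ℚ_[p])⁻¹‖} := by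
    ext b
    simp only [Set.mem_inter_iff, Set.mem_ofPred_eq, padic_norm_inv_prime]
    exact ⟨fun h => h.2, fun h => ⟨h ▸ one_lt_prime_cast p, h⟩⟩
  rw [hs, padic_setIntegral_normPow_norm_eq hμ padic_prime_inv_ne_zero,
    normPow_add padic_prime_inv_ne_zero, normPow_one, normPow, padic_norm_inv_prime]
  have hp : (p : ℂ) ≠ 0 := by exact_mod_cast (Fact.out : p.Prime).ne_zero
  simp [Measure.real, hμ]
  field_simp

/-- The integral of `|a| ^ (-1 - ν₁) * θ (-a * β ^ 2)` over `|a| > 1` and `|β| < 1`. -/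
noncomputable def gaussMass (μ : Measure ℚ_[p]) (θ : ℚ_[p] → ℂ) (ν₁ : ℂ) : ℂ :=
  ∫ z in {a : ℚ_[p] | 1 < ‖a‖} ×ˢ {β : ℚ_[p] | ‖β‖ < 1},
    normPow z.1 (-1 - ν₁) * θ (-z.2 ^ 2 * z.1) ∂(μ.prod μ)

lemma setIntegral_diagonalDomain (hθ : IsUnramifiedCharacter θ)
    (hμ : μ {x : ℚ_[p] | ‖x‖ ≤ 1} = 1) (h₂ : 1 < ν₂.re) :
    ∫ r in diagonalDomain p, normPow r.1.1 (-1 - ν₁) * θ (-r.1.2 ^ 2 * r.1.1) *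
      (normPow r.2.1 (-1 - ν₂) * θ (-1 * r.2.1) * 1) ∂((μ.prod μ).prod (μ.prod μ)) =
    -(gaussMass μ θ ν₁ * (p : ℂ) ^ (-1 - ν₂)) := by
  rw [diagonalDomain, setIntegral_prod_mul
    (fun z : ℚ_[p] × ℚ_[p] => normPow z.1 (-1 - ν₁) * θ (-z.2 ^ 2 * z.1))
    (fun z : ℚ_[p] × ℚ_[p] => normPow z.1 (-1 - ν₂) * θ (-1 * z.1) * 1), setIntegral_prod_mul
    (fun h : ℚ_[p] => normPow h (-1 - ν₂) * θ (-1 * h)) (fun _ => 1),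
    hθ.setIntegral_normPow_mul hμ (by simp; linarith) (by simp), ← gaussMass]
  simp [Measure.real, hμ]

lemma integrableOn_gauss (hθ : IsUnramifiedCharacter θ) (hμ : μ {x : ℚ_[p] | ‖x‖ ≤ 1} = 1)
    {s : ℂ} (hs : s.re < -1) :
    IntegrableOn (fun z : ℚ_[p] × ℚ_[p] => normPow z.1 s * θ (-z.2 ^ 2 * z.1))
      ({a : ℚ_[p] | 1 < ‖a‖} ×ˢ {β : ℚ_[p] | ‖β‖ ≤ 1}) (μ.prod μ) := by
  have hθm := hθ.cont.measurable
  refine IntegrableOn.of_bound_subset (IntegrableOn.mul_prod (padic_integrableOn_rpow hμ hs)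
    (padic_integrableOn_one hμ subset_rfl)) ?_ subset_rfl
    ((Measurable.normPow (by fun_prop) _).mul (hθm.comp (by fun_prop))) ?_
  · exact (padic_measurableSet_lt_norm 1).prod (padic_measurableSet_norm_le 1)
  · rintro ⟨a, β⟩ ⟨ha, -⟩
    simp only [norm_mul, hθ.unit, norm_normPow (ne_zero_of_one_lt_norm ha), mul_one, le_refl]

/-- Integration against `φ(β) |a| ^ s θ (-β² a)` over `|a| > 1` with `φ` supported on units. -/
lemma IsUnramifiedCharacter.integral_prod_unit (hθ : IsUnramifiedCharacter θ)
    (hμ : μ {x : ℚ_[p] | ‖x‖ ≤ 1} = 1) {W : ℚ_[p] → ℝ → ℂ}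
    (hW₀ : ∀ z, ∀ u ≤ 1, W z u = 0) (hc : ∀ z u, W z u ≠ 0 → ‖z‖ = 1)
    (hW : Integrable (fun r : ℚ_[p] × ℚ_[p] => W r.2 ‖r.1‖ * θ (-r.2 ^ 2 * r.1)) (μ.prod μ)) :
    ∫ r : ℚ_[p] × ℚ_[p], W r.2 ‖r.1‖ * θ (-r.2 ^ 2 * r.1) ∂(μ.prod μ) = -∫ z, W z p ∂μ := by
  rw [← hθ.integral_prod_norm hμ (c := fun z => -z ^ 2) (W := W) ?_ hW₀ hW.swap]
  · exact (integral_prod_swap (fun r : ℚ_[p] × ℚ_[p] => W r.2 ‖r.1‖ * θ (-r.2 ^ 2 * r.1))).symm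
  · intro z u h
    rw [norm_neg, norm_pow, hc z u h, one_pow]

lemma setIntegral_gauss_unit (hθ : IsUnramifiedCharacter θ) (hμ : μ {x : ℚ_[p] | ‖x‖ ≤ 1} = 1)
    {s : ℂ} (hs : s.re < -1) :
    ∫ z in {a : ℚ_[p] | 1 < ‖a‖} ×ˢ {β : ℚ_[p] | ‖β‖ = 1}, normPow z.1 s * θ (-z.2 ^ 2 * z.1)
      ∂(μ.prod μ) = -((1 - (p : ℂ)⁻¹) * (p : ℂ) ^ s) := by
  classical
  have hm : MeasurableSet ({a : ℚ_[p] | 1 < ‖a‖} ×ˢ {β : ℚ_[p] | ‖β‖ = 1}) :=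
    (padic_measurableSet_lt_norm 1).prod (padic_measurableSet_norm_eq 1)
  have hint : IntegrableOn (fun z : ℚ_[p] × ℚ_[p] => normPow z.1 s * θ (-z.2 ^ 2 * z.1))
      ({a : ℚ_[p] | 1 < ‖a‖} ×ˢ {β : ℚ_[p] | ‖β‖ = 1}) (μ.prod μ) :=
    (integrableOn_gauss hθ hμ hs).mono_set
      (Set.prod_mono_right fun β (hβ : ‖β‖ = 1) => hβ.le)
  let W : ℚ_[p] → ℝ → ℂ := fun z u => if 1 < u ∧ ‖z‖ = 1 then (u : ℂ) ^ s else 0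
  have hE : ({a : ℚ_[p] | 1 < ‖a‖} ×ˢ {β : ℚ_[p] | ‖β‖ = 1}).indicator
      (fun z => normPow z.1 s * θ (-z.2 ^ 2 * z.1)) =
      fun r : ℚ_[p] × ℚ_[p] => W r.2 ‖r.1‖ * θ (-r.2 ^ 2 * r.1) := by
    funext r
    simp only [Set.indicator_apply, Set.mem_prod, Set.mem_ofPred_eq, W, normPow, ite_mul, zero_mul]
  rw [← integrable_indicator_iff hm, hE] at hint
  rw [← integral_indicator hm, hE, hθ.integral_prod_unit hμ _ _ hint]
  · have : (fun z => W z p) = {z : ℚ_[p] | ‖z‖ = ‖(1 : ℚ_[p])‖}.indicator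
        fun _ => (p : ℂ) ^ s := by
      funext z
      simp [W, Set.indicator_apply, (Fact.out : p.Prime).one_lt]
    rw [this, integral_indicator (padic_measurableSet_norm_eq _), setIntegral_const,
      padic_measureReal_norm_eq hμ one_ne_zero]
    simp
  · intro z u hu
    exact if_neg fun h => absurd h.1 (not_lt.2 hu)
  · intro z u h
    by_contra h'
    exact h (if_neg fun h'' => h' h''.2)

end Evaluation

section GaussMass

variable {p : ℕ} [Fact p.Prime] [MeasurableSpace ℚ_[p]] [BorelSpace ℚ_[p]] {μ : Measure ℚ_[p]}
  [μ.IsAddHaarMeasure] {θ : ℚ_[p] → ℂ} {ν₁ ν₂ : ℂ}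

lemma padic_integral_prod_mul_left (hμ : μ {x : ℚ_[p] | ‖x‖ ≤ 1} = 1) {c d : ℚ_[p]} (hc : c ≠ 0)
    (hd : d ≠ 0) (g : ℚ_[p] × ℚ_[p] → ℂ) :
    (‖c‖ : ℂ) * (‖d‖ : ℂ) * ∫ z, g (c * z.1, d * z.2) ∂(μ.prod μ) = ∫ z, g z ∂(μ.prod μ) := by
  have e : MeasurableEmbedding (Prod.map (c * ·) (d * ·) : ℚ_[p] × ℚ_[p] → ℚ_[p] × ℚ_[p]) :=
    ((Homeomorph.mulLeft₀ c hc).prodCongr (Homeomorph.mulLeft₀ d hd)).measurableEmbedding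
  have h : (‖c‖₊ * ‖d‖₊) • (μ.prod μ).map (Prod.map (c * ·) (d * ·)) = μ.prod μ := by
    refine Eq.trans ?_
      (congrArg₂ Measure.prod (padic_map_mul_left μ hμ hc) (padic_map_mul_left μ hμ hd))
    rw [← Measure.map_prod_map μ μ (by fun_prop) (by fun_prop), mul_smul,
      Measure.prod_smul_left, Measure.prod_smul_right]
  conv_rhs => rw [← h]
  rw [integral_smul_nnreal_measure, e.integral_map, NNReal.smul_def]
  simp [Prod.map]

/-- The two largest spheres in the unit ball. -/
lemma padic_setIntegral_two_spheres (hμ : μ {x : ℚ_[p] | ‖x‖ ≤ 1} = 1) (s : ℂ) :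
    IntegrableOn (fun a => normPow a s) {a : ℚ_[p] | (p : ℝ)⁻¹ ≤ ‖a‖ ∧ ‖a‖ ≤ 1} μ ∧
    ∫ a in {a : ℚ_[p] | (p : ℝ)⁻¹ ≤ ‖a‖ ∧ ‖a‖ ≤ 1}, normPow a s ∂μ =
      (1 - (p : ℂ)⁻¹) * (1 + (p : ℂ) ^ (-1 - s)) := by
  have hs : {a : ℚ_[p] | (p : ℝ)⁻¹ ≤ ‖a‖ ∧ ‖a‖ ≤ 1} =
      {a | ‖a‖ = ‖(1 : ℚ_[p])‖} ∪ {a | ‖a‖ = ‖(p : ℚ_[p])‖} := by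
    ext a
    have := one_lt_prime_cast p
    simp only [Set.mem_union, Set.mem_ofPred_eq, norm_one, Padic.norm_p]
    constructor
    · rintro ⟨h, h'⟩
      rcases h'.lt_or_eq with h'' | h''
      · exact Or.inr (le_antisymm ((padic_norm_lt_one_iff a).1 h'') h)
      · exact Or.inl h''
    · rintro (h | h) <;> rw [h]
      · exact ⟨inv_le_one_of_one_le₀ this.le, le_rfl⟩
      · exact ⟨le_rfl, inv_le_one_of_one_le₀ this.le⟩
  have hi : ∀ d : ℚ_[p], d ≠ 0 → IntegrableOn (fun a => normPow a s) {a | ‖a‖ = ‖d‖} μ := by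
    intro d hd
    refine IntegrableOn.congr_fun (f := fun _ => normPow d s) (integrableOn_const ?_)
      (fun a (ha : ‖a‖ = ‖d‖) => normPow_congr ha.symm s) (padic_measurableSet_norm_eq _)
    exact measure_ne_top_of_subset (fun a (ha : ‖a‖ = ‖d‖) => ha.le)
      (padic_measure_norm_le_ne_top hμ hd)
  have hd : Disjoint {a : ℚ_[p] | ‖a‖ = ‖(1 : ℚ_[p])‖} {a | ‖a‖ = ‖(p : ℚ_[p])‖} := by
    rw [Set.disjoint_left]
    intro a (h : ‖a‖ = _) (h' : ‖a‖ = _)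
    rw [h, norm_one, Padic.norm_p] at h'
    exact absurd h' (inv_lt_one_of_one_lt₀ (one_lt_prime_cast p)).ne'
  have h1 := hi 1 one_ne_zero
  have h2 := hi p padic_prime_ne_zero
  rw [hs]
  refine ⟨h1.union h2, ?_⟩
  rw [setIntegral_union hd (padic_measurableSet_norm_eq _) h1 h2,
    padic_setIntegral_normPow_norm_eq hμ one_ne_zero,
    padic_setIntegral_normPow_norm_eq hμ padic_prime_ne_zero, normPow_eq_one norm_one, normPow,
    Padic.norm_p, ← mul_add, show -1 - s = -(1 + s) by ring]
  congr 2
  push_cast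
  rw [Complex.inv_cpow _ _ (by simp [Real.pi_ne_zero.symm]), Complex.cpow_neg]

lemma gaussMass_eq (hθ : IsUnramifiedCharacter θ) (hμ : μ {x : ℚ_[p] | ‖x‖ ≤ 1} = 1)
    (hν : 0 < ν₁.re) :
    gaussMass μ θ ν₁ = (p : ℂ) ^ (-1 - 2 * ν₁) * (gaussMass μ θ ν₁ -
      (1 - (p : ℂ)⁻¹) * (p : ℂ) ^ (-1 - ν₁) + (1 - (p : ℂ)⁻¹) * (1 + (p : ℂ) ^ ν₁)) := by
  have hp : (p : ℂ) ≠ 0 := by exact_mod_cast (Fact.out : p.Prime).ne_zero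
  have hp0 := prime_cast_pos p
  have hs : (-1 - ν₁).re < -1 := by simp; linarith
  let f : ℚ_[p] × ℚ_[p] → ℂ := fun z => normPow z.1 (-1 - ν₁) * θ (-z.2 ^ 2 * z.1)
  let S₀ : Set (ℚ_[p] × ℚ_[p]) := {a | 1 < ‖a‖} ×ˢ {β | ‖β‖ < 1}
  let S₁ : Set (ℚ_[p] × ℚ_[p]) := {a | 1 < ‖a‖} ×ˢ {β | ‖β‖ = 1}
  let S₂ : Set (ℚ_[p] × ℚ_[p]) := {a | (p : ℝ)⁻¹ ≤ ‖a‖ ∧ ‖a‖ ≤ 1} ×ˢ {β | ‖β‖ ≤ 1}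
  have m₀ : MeasurableSet S₀ := (padic_measurableSet_lt_norm 1).prod (padic_measurableSet_norm_lt 1)
  have m₁ : MeasurableSet S₁ := (padic_measurableSet_lt_norm 1).prod (padic_measurableSet_norm_eq 1)
  have m₂ : MeasurableSet S₂ :=
    MeasurableSet.prod ((measurableSet_le (f := fun _ : ℚ_[p] => (p : ℝ)⁻¹) (by fun_prop)
      (by fun_prop)).inter (padic_measurableSet_norm_le 1)) (padic_measurableSet_norm_le 1)
  have i₀ : IntegrableOn f S₀ (μ.prod μ) := (integrableOn_gauss hθ hμ hs).mono_set
    (Set.prod_mono_right fun β (hβ : ‖β‖ < 1) => hβ.le)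
  have i₁ : IntegrableOn f S₁ (μ.prod μ) := (integrableOn_gauss hθ hμ hs).mono_set
    (Set.prod_mono_right fun β (hβ : ‖β‖ = 1) => hβ.le)
  have hf₂ : Set.EqOn (fun z : ℚ_[p] × ℚ_[p] => normPow z.1 (-1 - ν₁) * 1) f S₂ := by
    rintro ⟨a, β⟩ ⟨⟨-, ha⟩, hβ⟩
    have hβ' : ‖β‖ ≤ 1 := hβ
    simp only [f]
    rw [hθ.triv]
    rw [norm_mul, norm_neg, norm_pow]
    exact mul_le_one₀ (pow_le_one₀ (norm_nonneg _) hβ') (norm_nonneg _) ha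
  have i₂ : IntegrableOn f S₂ (μ.prod μ) :=
    (IntegrableOn.mul_prod (padic_setIntegral_two_spheres hμ _).1
      (integrableOn_const (by simp [hμ]))).congr_fun hf₂ m₂
  have e₂ : ∫ z in S₂, f z ∂(μ.prod μ) = (1 - (p : ℂ)⁻¹) * (1 + (p : ℂ) ^ ν₁) := by
    rw [← setIntegral_congr_fun m₂ hf₂, setIntegral_prod_mul (fun a => normPow a (-1 - ν₁))
      (fun _ => 1), (padic_setIntegral_two_spheres hμ _).2]
    simp [Measure.real, hμ]
  have d₀₁ : Disjoint S₀ S₁ := by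
    rw [Set.disjoint_left]
    rintro ⟨a, β⟩ ⟨-, h⟩ ⟨-, h'⟩
    exact (show ‖β‖ < 1 from h).ne h'
  have d₂ : Disjoint (S₀ ∪ S₁) S₂ := by
    rw [Set.disjoint_left]
    rintro ⟨a, β⟩ (⟨h, -⟩ | ⟨h, -⟩) ⟨⟨-, h'⟩, -⟩ <;> exact not_lt.2 h' h
  have hsub : ∀ z : ℚ_[p] × ℚ_[p], S₀.indicator f ((p : ℚ_[p])⁻¹ ^ 2 * z.1, p * z.2) =
      (p : ℂ) ^ (-2 - 2 * ν₁) * (S₀ ∪ S₁ ∪ S₂).indicator f z := by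
    rintro ⟨a, β⟩
    have h0 : ‖(p : ℚ_[p])⁻¹ ^ 2 * a‖ = p ^ 2 * ‖a‖ := by
      rw [norm_mul, norm_pow, padic_norm_inv_prime]
    have h1 : 1 < ‖(p : ℚ_[p])⁻¹ ^ 2 * a‖ ↔ (p : ℝ)⁻¹ ≤ ‖a‖ := by
      rw [padic_one_lt_norm_iff, h0, inv_le_iff_one_le_mul₀ hp0, sq, mul_assoc,
        le_mul_iff_one_le_right hp0, mul_comm]
    have h2 : ‖(p : ℚ_[p]) * β‖ < 1 ↔ ‖β‖ ≤ 1 := by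
      rw [padic_norm_lt_one_iff, padic_norm_prime_mul, mul_le_iff_le_one_right (inv_pos.2 hp0)]
    have h3 : ((p : ℚ_[p])⁻¹ ^ 2 * a, (p : ℚ_[p]) * β) ∈ S₀ ↔ (a, β) ∈ S₀ ∪ S₁ ∪ S₂ := by
      have hp1 : (p : ℝ)⁻¹ ≤ 1 := inv_le_one_of_one_le₀ (one_lt_prime_cast p).le
      simp only [S₀, S₁, S₂, Set.mem_union, Set.mem_prod, Set.mem_ofPred_eq, h1, h2, ← and_or_left,
        ← le_iff_lt_or_eq, ← or_and_right]
      refine and_congr_left fun _ => ⟨fun h => ?_, ?_⟩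
      · exact (lt_or_ge 1 ‖a‖).imp_right fun h' => ⟨h, h'⟩
      · rintro (h | h)
        · exact hp1.trans h.le
        · exact h.1
    by_cases h : (a, β) ∈ S₀ ∪ S₁ ∪ S₂
    · rw [Set.indicator_of_mem h, Set.indicator_of_mem (h3.2 h)]
      simp only [f]
      rw [show -((p : ℚ_[p]) * β) ^ 2 * ((p : ℚ_[p])⁻¹ ^ 2 * a) = -β ^ 2 * a by
        have := padic_prime_ne_zero (p := p); field_simp, normPow_mul, mul_assoc]
      congr 1
      rw [sq, normPow_mul, normPow, padic_norm_inv_prime, Complex.ofReal_natCast,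
        ← Complex.cpow_add _ _ hp]
      congr 1; ring
    · rw [Set.indicator_of_notMem h, Set.indicator_of_notMem (fun h' => h (h3.1 h')), mul_zero]
  have key := padic_integral_prod_mul_left hμ (pow_ne_zero 2 (padic_prime_inv_ne_zero (p := p)))
    (padic_prime_ne_zero (p := p)) (S₀.indicator f)
  simp only [hsub] at key
  rw [integral_const_mul, integral_indicator ((m₀.union m₁).union m₂), integral_indicator m₀,
    setIntegral_union d₂ m₂ (i₀.union i₁) i₂, setIntegral_union d₀₁ m₁ i₀ i₁,
    setIntegral_gauss_unit hθ hμ hs, e₂, norm_pow, padic_norm_inv_prime, Padic.norm_p,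
    ← sub_eq_add_neg] at key
  change _ = gaussMass μ θ ν₁ at key
  change _ * (_ * (gaussMass μ θ ν₁ - _ + _)) = _ at key
  conv_lhs => rw [← key]
  have h : (p : ℂ) ^ (-1 - 2 * ν₁) = p * (p : ℂ) ^ (-2 - 2 * ν₁) := by
    rw [show -1 - 2 * ν₁ = 1 + (-2 - 2 * ν₁) by ring, Complex.cpow_add _ _ hp, Complex.cpow_one]
  rw [h]
  push_cast
  field_simp

end GaussMass

section RescaledIntegral

variable {p : ℕ} [Fact p.Prime]

lemma padic_norm_one_add_le {z : ℚ_[p]} (hz : ‖z‖ ≤ 1) : ‖1 + z‖ ≤ 1 :=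
  (Padic.nonarchimedean _ _).trans (max_le norm_one.le hz)

lemma padic_one_lt_prime_mul_norm_iff {z : ℚ_[p]} (hz : ‖z‖ ≤ 1) : 1 < p * ‖z‖ ↔ ‖z‖ = 1 := by
  have hp := prime_cast_pos p
  refine ⟨fun h => hz.eq_of_not_lt fun h' => ?_, fun h => ?_⟩
  · rw [padic_norm_lt_one_iff] at h'
    have := mul_le_mul_of_nonneg_left h' hp.le
    rw [mul_inv_cancel₀ hp.ne'] at this
    exact not_lt.2 this h
  · rw [h, mul_one]
    exact one_lt_prime_cast p

variable [MeasurableSpace ℚ_[p]] [BorelSpace ℚ_[p]] {μ : Measure ℚ_[p]}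
  [μ.IsAddHaarMeasure] {θ : ℚ_[p] → ℂ} {ν₁ ν₂ : ℂ}

/-- The part of the plane over which the integral over `rescaledDomain p` is concentrated. -/
def residualDomain (p : ℕ) [Fact p.Prime] : Set (ℚ_[p] × ℚ_[p]) :=
  {z | ‖z.2‖ ≤ 1 ∧ 1 < ‖z.1‖ * ‖1 + z.2‖}

/-- The factor of `rescaledKernel` depending on the first two variables. -/
noncomputable def residualKernel (θ : ℚ_[p] → ℂ) (ν₁ ν₂ : ℂ) (z : ℚ_[p] × ℚ_[p]) : ℂ :=
  normPow z.1 (-1 - ν₁) * normPow (1 + z.2) (-1 - ν₁ + ν₂) * θ (-z.2 ^ 2 * z.1)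

lemma measurableSet_residualDomain : MeasurableSet (residualDomain p) :=
  (measurableSet_le (f := fun z : ℚ_[p] × ℚ_[p] => ‖z.2‖) (by fun_prop) (by fun_prop)).inter
    (measurableSet_lt (g := fun z : ℚ_[p] × ℚ_[p] => ‖z.1‖ * ‖1 + z.2‖)
      (by fun_prop) (by fun_prop))

lemma setIntegral_residual_unit (hθ : IsUnramifiedCharacter θ) (hμ : μ {x : ℚ_[p] | ‖x‖ ≤ 1} = 1)
    (hint : IntegrableOn (residualKernel θ ν₁ ν₂) (residualDomain p) (μ.prod μ)) :
    ∫ z in residualDomain p ∩ {z | ‖z.2‖ = 1}, residualKernel θ ν₁ ν₂ z ∂(μ.prod μ) =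
      -((1 - 2 * (p : ℂ)⁻¹) * (p : ℂ) ^ (-1 - ν₁)) := by
  classical
  have hm : MeasurableSet (residualDomain p ∩ {z : ℚ_[p] × ℚ_[p] | ‖z.2‖ = 1}) :=
    measurableSet_residualDomain.inter (measurableSet_eq_fun (by fun_prop) (by fun_prop))
  let W : ℚ_[p] → ℝ → ℂ := fun z u => if ‖z‖ = 1 ∧ 1 < u * ‖1 + z‖ then
    (u : ℂ) ^ (-1 - ν₁) * normPow (1 + z) (-1 - ν₁ + ν₂) else 0
  have hE : (residualDomain p ∩ {z : ℚ_[p] × ℚ_[p] | ‖z.2‖ = 1}).indicator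
      (residualKernel θ ν₁ ν₂) = fun r => W r.2 ‖r.1‖ * θ (-r.2 ^ 2 * r.1) := by
    funext r
    have : r ∈ residualDomain p ∩ {z : ℚ_[p] × ℚ_[p] | ‖z.2‖ = 1} ↔
        ‖r.2‖ = 1 ∧ 1 < ‖r.1‖ * ‖1 + r.2‖ :=
      ⟨fun h => ⟨h.2, h.1.2⟩, fun h => ⟨⟨h.1.le, h.2⟩, h.1⟩⟩
    simp only [Set.indicator_apply, this, W, residualKernel, normPow, ite_mul, zero_mul]
  have hi := hint.mono_set (s := residualDomain p ∩ {z | ‖z.2‖ = 1}) Set.inter_subset_left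
  rw [← integrable_indicator_iff hm, hE] at hi
  rw [← integral_indicator hm, hE, hθ.integral_prod_unit hμ _ _ hi]
  · have : (fun z => W z p) = {z : ℚ_[p] | ‖z‖ = 1 ∧ ‖1 + z‖ = 1}.indicator
        fun _ => (p : ℂ) ^ (-1 - ν₁) := by
      funext z
      by_cases h : ‖z‖ = 1 ∧ ‖1 + z‖ = 1
      · rw [Set.indicator_of_mem (show z ∈ {z : ℚ_[p] | ‖z‖ = 1 ∧ ‖1 + z‖ = 1} from h)]
        simp only [W]
        rw [if_pos ⟨h.1, (padic_one_lt_prime_mul_norm_iff h.2.le).2 h.2⟩, normPow_eq_one h.2]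
        simp
      · rw [Set.indicator_of_notMem (show z ∉ {z : ℚ_[p] | ‖z‖ = 1 ∧ ‖1 + z‖ = 1} from h)]
        exact if_neg fun h' => h ⟨h'.1,
          (padic_one_lt_prime_mul_norm_iff (padic_norm_one_add_le h'.1.le)).1 h'.2⟩
    rw [this, integral_indicator, setIntegral_const, padic_measureReal_norm_eq_one_inter hμ]
    · simp
    · exact (padic_measurableSet_norm_eq 1).inter (measurableSet_eq_fun (by fun_prop) (by fun_prop))
  · intro z u hu
    refine if_neg fun h => not_lt.2 ?_ h.2
    exact (mul_le_of_le_one_left (norm_nonneg _) hu).trans (padic_norm_one_add_le h.1.le)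
  · intro z u h
    by_contra h'
    exact h (if_neg fun h'' => h' h''.1)

lemma setIntegral_residual (hθ : IsUnramifiedCharacter θ) (hμ : μ {x : ℚ_[p] | ‖x‖ ≤ 1} = 1)
    (hint : IntegrableOn (residualKernel θ ν₁ ν₂) (residualDomain p) (μ.prod μ)) :
    ∫ z in residualDomain p, residualKernel θ ν₁ ν₂ z ∂(μ.prod μ) =
      gaussMass μ θ ν₁ - (1 - 2 * (p : ℂ)⁻¹) * (p : ℂ) ^ (-1 - ν₁) := by
  have hone : ∀ {β : ℚ_[p]}, ‖β‖ < 1 → ‖1 + β‖ = 1 := fun {β} h => by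
    rw [padic_norm_add_eq_left (by rwa [norm_one]), norm_one]
  have hs : residualDomain p =
      {a : ℚ_[p] | 1 < ‖a‖} ×ˢ {β : ℚ_[p] | ‖β‖ < 1} ∪
        residualDomain p ∩ {z | ‖z.2‖ = 1} := by
    ext ⟨a, β⟩
    simp only [residualDomain, Set.mem_union, Set.mem_prod, Set.mem_inter_iff, Set.mem_ofPred_eq]
    constructor
    · rintro ⟨h1, h2⟩
      rcases h1.lt_or_eq with h | h
      · exact Or.inl ⟨by rwa [hone h, mul_one] at h2, h⟩
      · exact Or.inr ⟨⟨h1, h2⟩, h⟩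
    · rintro (⟨h1, h2⟩ | h)
      · exact ⟨h2.le, by rwa [hone h2, mul_one]⟩
      · exact h.1
  have m₀ : MeasurableSet ({a : ℚ_[p] | 1 < ‖a‖} ×ˢ {β : ℚ_[p] | ‖β‖ < 1}) :=
    (padic_measurableSet_lt_norm 1).prod (padic_measurableSet_norm_lt 1)
  have hd : Disjoint ({a : ℚ_[p] | 1 < ‖a‖} ×ˢ {β : ℚ_[p] | ‖β‖ < 1})
      (residualDomain p ∩ {z | ‖z.2‖ = 1}) := by
    rw [Set.disjoint_left]
    rintro ⟨a, β⟩ ⟨-, h⟩ ⟨-, h'⟩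
    exact (show ‖β‖ < 1 from h).ne h'
  conv_lhs => rw [hs]
  rw [setIntegral_union hd (measurableSet_residualDomain.inter
      (measurableSet_eq_fun (by fun_prop) (by fun_prop)))
    (hint.mono_set (by conv_rhs => rw [hs]
                       exact Set.subset_union_left))
    (hint.mono_set Set.inter_subset_left), setIntegral_residual_unit hθ hμ hint,
    ← sub_eq_add_neg]
  refine congrArg (· - _) (setIntegral_congr_fun m₀ ?_)
  rintro ⟨a, β⟩ ⟨-, h⟩
  simp only [residualKernel]
  rw [normPow_eq_one (hone h), mul_one]

lemma integral_squaredDomain (hθ : IsUnramifiedCharacter θ)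
    (hμ : μ {x : ℚ_[p] | ‖x‖ ≤ 1} = 1) (h₂ : 1 < ν₂.re) (h₁ : 1 < (ν₁ - ν₂).re) :
    ∫ r in squaredDomain p, squaredKernel θ ν₁ ν₂ r ∂((μ.prod μ).prod (μ.prod μ)) =
      (gaussMass μ θ ν₁ - (1 - 2 * (p : ℂ)⁻¹) * (p : ℂ) ^ (-1 - ν₁)) *
        ((p : ℂ) ^ (-1 - ν₂) * (p : ℂ) ^ (-1 - 2 * ν₁)) := by
  classical
  have hp := prime_cast_pos p
  have hp1 := one_lt_prime_cast p
  have hpc : (p : ℂ) ≠ 0 := by exact_mod_cast (Fact.out : p.Prime).ne_zero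
  let W : ℚ_[p] × ℚ_[p] → ℝ → ℝ → ℂ := fun z u v =>
    if 1 < u ∧ 1 < v ∧ ‖z.2‖ < v ∧ u < ‖z.1‖ * ‖1 + z.2‖ * v then
      residualKernel θ ν₁ ν₂ z * ((u : ℂ) ^ (-1 - ν₂) * (v : ℂ) ^ (-1 - 2 * ν₁)) else 0
  have hE : (rescaledDomain p).indicator (rescaledKernel θ ν₁ ν₂) =
      fun r => W r.1 ‖r.2.1‖ ‖r.2.2‖ * (θ (-1 * r.2.1) * θ (-1 * r.2.2)) := by
    funext r
    simp only [Set.indicator_apply, rescaledDomain, Set.mem_ofPred_eq, W, rescaledKernel,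
      residualKernel, normPow, ite_mul, zero_mul]
  have hWp : (fun z => W z p p) = (residualDomain p).indicator fun z =>
      residualKernel θ ν₁ ν₂ z * ((p : ℂ) ^ (-1 - ν₂) * (p : ℂ) ^ (-1 - 2 * ν₁)) := by
    funext z
    have : (1 < (p : ℝ) ∧ 1 < (p : ℝ) ∧ ‖z.2‖ < p ∧ (p : ℝ) < ‖z.1‖ * ‖1 + z.2‖ * p) ↔
        z ∈ residualDomain p := by
      simp only [hp1, true_and, padic_norm_lt_prime_iff, lt_mul_iff_one_lt_left hp]
      rfl
    simp only [W, this, Set.indicator_apply, Complex.ofReal_natCast]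
  have hm := (measurable_squaredKernel hθ (ν₁ := ν₁) (ν₂ := ν₂)).indicator
    (measurableSet_squaredDomain (p := p))
  have hJ : Measurable fun r : (ℚ_[p] × ℚ_[p]) × (ℚ_[p] × ℚ_[p]) => ‖r.2.2‖₊ := by fun_prop
  have hint : Integrable (fun r => W r.1 ‖r.2.1‖ ‖r.2.2‖ * (θ (-1 * r.2.1) * θ (-1 * r.2.2)))
      ((μ.prod μ).prod (μ.prod μ)) := by
    rw [← hE, ← (padic_measurePreserving_rescale μ hμ).integrable_iff_of_density hJ hm
      rescaledDomain_transfer, integrable_indicator_iff measurableSet_squaredDomain]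
    exact integrableOn_squaredDomain hθ hμ h₂ h₁
  obtain ⟨h1, h2⟩ := hθ.integral_prod_norm_norm hμ (W := W)
    (fun z v u hu => if_neg fun h => not_lt.2 hu h.1)
    (fun z u v hv => if_neg fun h => not_lt.2 hv h.2.1) hint
  rw [← integral_indicator measurableSet_squaredDomain,
    (padic_measurePreserving_rescale μ hμ).integral_eq_of_density hJ hm rescaledDomain_transfer,
    hE, h2, hWp, integral_indicator measurableSet_residualDomain, integral_mul_const,
    setIntegral_residual hθ hμ]
  rw [hWp, integrable_indicator_iff measurableSet_residualDomain] at h1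
  have hne : (p : ℂ) ^ (-1 - ν₂) * (p : ℂ) ^ (-1 - 2 * ν₁) ≠ 0 := by simp [hpc]
  exact (integrable_mul_const_iff hne.isUnit _).1 h1

end RescaledIntegral

section Assembly

variable {p : ℕ} [Fact p.Prime] [MeasurableSpace ℚ_[p]]

lemma binaryFormDomain_prodAssoc :
    {q : ℚ_[p] × ℚ_[p] × ℚ_[p] × ℚ_[p] | Padic.addValuation (q.1 * q.2.2.1 - q.2.1 ^ 2) <
        min (Padic.addValuation q.1)
          (min (Padic.addValuation q.2.1) (Padic.addValuation q.2.2.1)) ∧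
      Padic.addValuation (q.1 + q.2.1 * q.2.2.2) <
        Padic.addValuation (q.2.1 + q.2.2.1 * q.2.2.2)} =
    MeasurableEquiv.prodAssoc.symm ⁻¹' binaryFormDomain p := by
  ext ⟨a, b, c, x⟩
  simp only [Set.mem_ofPred_eq, lt_min_iff, padic_addValuation_lt_iff]
  rfl

variable [BorelSpace ℚ_[p]] {μ : Measure ℚ_[p]}
  [μ.IsAddHaarMeasure] {θ : ℚ_[p] → ℂ} {ν₁ ν₂ : ℂ}

lemma measurable_shearedKernel (hθ : IsUnramifiedCharacter θ) :
    Measurable (shearedKernel θ ν₁ ν₂) := by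
  have := hθ.cont
  exact ((Measurable.normPow (by fun_prop) _).mul (Measurable.normPow (by fun_prop) _)).mul
    (this.measurable.comp (by fun_prop))

lemma measurableSet_shearedDomain : MeasurableSet (shearedDomain p) :=
  (measurableSet_detDominates (a := fun r : (ℚ_[p] × ℚ_[p]) × (ℚ_[p] × ℚ_[p]) => r.1.1)
    (b := fun r => r.1.2) (c := fun r => r.2.1) (by fun_prop) (by fun_prop) (by fun_prop)).inter
    ((measurableSet_lt (f := fun r : (ℚ_[p] × ℚ_[p]) × (ℚ_[p] × ℚ_[p]) => ‖r.1.2‖)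
      (g := fun r => ‖r.1.1‖) (by fun_prop) (by fun_prop)).inter
      (measurableSet_le (f := fun r : (ℚ_[p] × ℚ_[p]) × (ℚ_[p] × ℚ_[p]) => ‖r.2.2‖)
        (g := fun _ => 1) (by fun_prop) (by fun_prop)))

lemma binaryForm_large_upper (hθ : IsUnramifiedCharacter θ)
    (hμ : μ {x : ℚ_[p] | ‖x‖ ≤ 1} = 1) (h₂ : 1 < ν₂.re) (h₁ : 1 < (ν₁ - ν₂).re)
    (hm : MeasurableSet (binaryFormDomain p ∩ {r | 1 < ‖r.2.2‖ ∧ ‖r.1.1‖ ≤ ‖r.1.2‖})) :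
    IntegrableOn (binaryFormKernel θ ν₁ ν₂)
      (binaryFormDomain p ∩ {r | 1 < ‖r.2.2‖ ∧ ‖r.1.1‖ ≤ ‖r.1.2‖})
      ((μ.prod μ).prod (μ.prod μ)) ∧
    ∫ r in binaryFormDomain p ∩ {r | 1 < ‖r.2.2‖ ∧ ‖r.1.1‖ ≤ ‖r.1.2‖},
      binaryFormKernel θ ν₁ ν₂ r ∂((μ.prod μ).prod (μ.prod μ)) =
    -((1 - (p : ℂ)⁻¹) * (p : ℂ) ^ (-1 - ν₁ - ν₂) * (p : ℂ) ^ (-1 - ν₁ + ν₂)) := by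
  have hJ : Measurable fun r : (ℚ_[p] × ℚ_[p]) × (ℚ_[p] × ℚ_[p]) => ‖r.1.2‖₊ ^ 2 := by fun_prop
  have hS : MeasurableSet (scaledDomain p) :=
    ((padic_measurableSet_norm_le 1).prod (padic_measurableSet_lt_norm 1)).prod
      ((padic_measurableSet_norm_lt 1).prod (padic_measurableSet_lt_norm 1))
  have hk := (measurable_binaryFormKernel hθ (ν₁ := ν₁) (ν₂ := ν₂)).indicator hm
  have hΦ := padic_measurePreserving_scale μ hμ
  have ht := scaledDomain_transfer hθ (ν₁ := ν₁) (ν₂ := ν₂)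
  rw [← integrable_indicator_iff hm, ← integral_indicator hm,
    hΦ.integrable_iff_of_density hJ hk ht, hΦ.integral_eq_of_density hJ hk ht,
    integrable_indicator_iff hS, integral_indicator hS]
  exact ⟨integrableOn_scaledDomain hθ hμ h₂ h₁, setIntegral_scaledDomain hθ hμ h₂ h₁⟩

lemma binaryForm_large_lower (hθ : IsUnramifiedCharacter θ)
    (hμ : μ {x : ℚ_[p] | ‖x‖ ≤ 1} = 1) (h₂ : 1 < ν₂.re) (h₁ : 1 < (ν₁ - ν₂).re)
    (hm : MeasurableSet (binaryFormDomain p ∩ {r | 1 < ‖r.2.2‖ ∧ ‖r.1.2‖ < ‖r.1.1‖})) :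
    IntegrableOn (binaryFormKernel θ ν₁ ν₂)
      (binaryFormDomain p ∩ {r | 1 < ‖r.2.2‖ ∧ ‖r.1.2‖ < ‖r.1.1‖})
      ((μ.prod μ).prod (μ.prod μ)) ∧
    ∫ r in binaryFormDomain p ∩ {r | 1 < ‖r.2.2‖ ∧ ‖r.1.2‖ < ‖r.1.1‖},
      binaryFormKernel θ ν₁ ν₂ r ∂((μ.prod μ).prod (μ.prod μ)) =
    (gaussMass μ θ ν₁ - (1 - 2 * (p : ℂ)⁻¹) * (p : ℂ) ^ (-1 - ν₁)) *
        ((p : ℂ) ^ (-1 - ν₂) * (p : ℂ) ^ (-1 - 2 * ν₁)) := by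
  have hJ : Measurable fun r : (ℚ_[p] × ℚ_[p]) × (ℚ_[p] × ℚ_[p]) => ‖r.1.1‖₊ := by fun_prop
  have hk := (measurable_binaryFormKernel hθ (ν₁ := ν₁) (ν₂ := ν₂)).indicator hm
  have hΦ := padic_measurePreserving_square μ hμ
  have ht := squaredDomain_transfer hθ (ν₁ := ν₁) (ν₂ := ν₂)
  rw [← integrable_indicator_iff hm, ← integral_indicator hm,
    hΦ.integrable_iff_of_density hJ hk ht, hΦ.integral_eq_of_density hJ hk ht,
    integrable_indicator_iff measurableSet_squaredDomain,
    integral_indicator measurableSet_squaredDomain]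
  exact ⟨integrableOn_squaredDomain hθ hμ h₂ h₁, integral_squaredDomain hθ hμ h₂ h₁⟩

lemma binaryForm_small (hθ : IsUnramifiedCharacter θ)
    (hμ : μ {x : ℚ_[p] | ‖x‖ ≤ 1} = 1) (h₂ : 1 < ν₂.re) (h₁ : 1 < (ν₁ - ν₂).re)
    (hm : MeasurableSet (binaryFormDomain p ∩ {r | ‖r.2.2‖ ≤ 1})) :
    IntegrableOn (binaryFormKernel θ ν₁ ν₂) (binaryFormDomain p ∩ {r | ‖r.2.2‖ ≤ 1})
      ((μ.prod μ).prod (μ.prod μ)) ∧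
    ∫ r in binaryFormDomain p ∩ {r | ‖r.2.2‖ ≤ 1},
      binaryFormKernel θ ν₁ ν₂ r ∂((μ.prod μ).prod (μ.prod μ)) =
    -(gaussMass μ θ ν₁ * (p : ℂ) ^ (-1 - ν₂)) := by
  have hJ : Measurable fun r : (ℚ_[p] × ℚ_[p]) × (ℚ_[p] × ℚ_[p]) => ‖r.1.1‖₊ := by fun_prop
  have hJ₁ : Measurable fun _ : (ℚ_[p] × ℚ_[p]) × (ℚ_[p] × ℚ_[p]) => (1 : ℝ≥0) := by fun_prop
  have hS : MeasurableSet (diagonalDomain p) :=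
    ((padic_measurableSet_lt_norm 1).prod (padic_measurableSet_norm_lt 1)).prod
      ((padic_measurableSet_lt_norm 1).prod (padic_measurableSet_norm_le 1))
  have hk := (measurable_binaryFormKernel hθ (ν₁ := ν₁) (ν₂ := ν₂)).indicator hm
  have hk₁ := (measurable_shearedKernel hθ (ν₁ := ν₁) (ν₂ := ν₂)).indicator
    (measurableSet_shearedDomain (p := p))
  have hΦ := padic_measurePreserving_square μ hμ
  have hΦ₁ := padic_measurePreserving_shear μ
  have ht := diagonalDomain_transfer hθ (ν₁ := ν₁) (ν₂ := ν₂)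
  have ht₁ := shearedDomain_transfer hθ (ν₁ := ν₁) (ν₂ := ν₂)
  rw [← integrable_indicator_iff hm, ← integral_indicator hm,
    hΦ₁.integrable_iff_of_density hJ₁ hk ht₁, hΦ₁.integral_eq_of_density hJ₁ hk ht₁,
    hΦ.integrable_iff_of_density hJ hk₁ ht, hΦ.integral_eq_of_density hJ hk₁ ht,
    integrable_indicator_iff hS, integral_indicator hS]
  exact ⟨integrableOn_diagonalDomain hθ hμ h₂ h₁, setIntegral_diagonalDomain hθ hμ h₂⟩

lemma binaryForm_pieces_sum {P Q R K : ℂ} (hP : P ≠ 0) (hK : K = P⁻¹ * Q ^ 2 *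
    (K - (1 - P⁻¹) * (P⁻¹ * Q) + (1 - P⁻¹) * (1 + Q⁻¹))) (hQ : Q ≠ 0) :
    -((1 - P⁻¹) * (P⁻¹ ^ 2 * Q ^ 2)) +
      (K - (1 - 2 * P⁻¹) * (P⁻¹ * Q)) * (P⁻¹ * R * (P⁻¹ * Q ^ 2)) + -(K * (P⁻¹ * R)) =
    -((1 - P⁻¹) * (P⁻¹ ^ 2 * Q * R)) - (1 - P⁻¹) * (P⁻¹ ^ 2 * Q ^ 2) -
      (1 - P⁻¹) * (P⁻¹ ^ 2 * Q ^ 2 * R) + P⁻¹ ^ 4 * Q ^ 3 * R := by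
  have h : P⁻¹ * Q ^ 2 * (1 + Q⁻¹) = P⁻¹ * (Q ^ 2 + Q) := by field_simp
  linear_combination (-(P⁻¹ * R)) * hK - (P⁻¹ * R) * (1 - P⁻¹) * h

lemma binaryForm_integral (hθ : IsUnramifiedCharacter θ)
    (hμ : μ {x : ℚ_[p] | ‖x‖ ≤ 1} = 1) (h₂ : 1 < ν₂.re) (h₁ : 1 < (ν₁ - ν₂).re) :
    IntegrableOn (binaryFormKernel θ ν₁ ν₂) (binaryFormDomain p)
      ((μ.prod μ).prod (μ.prod μ)) ∧
    ∫ r in binaryFormDomain p, binaryFormKernel θ ν₁ ν₂ r ∂((μ.prod μ).prod (μ.prod μ)) =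
      -((1 - (p : ℂ)⁻¹) * (p : ℂ) ^ (-2 - ν₁ - ν₂)) -
          (1 - (p : ℂ)⁻¹) * (p : ℂ) ^ (-2 - 2 * ν₁) -
          (1 - (p : ℂ)⁻¹) * (p : ℂ) ^ (-2 - 2 * ν₁ - ν₂) +
          (p : ℂ) ^ (-4 - 3 * ν₁ - ν₂) := by
  have hp : (p : ℂ) ≠ 0 := by exact_mod_cast (Fact.out : p.Prime).ne_zero
  have hD := measurableSet_binaryFormDomain (p := p)
  have hx : MeasurableSet {r : (ℚ_[p] × ℚ_[p]) × (ℚ_[p] × ℚ_[p]) | 1 < ‖r.2.2‖} :=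
    measurableSet_lt (f := fun _ => 1) (by fun_prop) (by fun_prop)
  have mA : MeasurableSet (binaryFormDomain p ∩ {r | 1 < ‖r.2.2‖ ∧ ‖r.1.1‖ ≤ ‖r.1.2‖}) :=
    hD.inter (hx.inter (measurableSet_le
      (f := fun r : (ℚ_[p] × ℚ_[p]) × (ℚ_[p] × ℚ_[p]) => ‖r.1.1‖) (g := fun r => ‖r.1.2‖)
      (by fun_prop) (by fun_prop)))
  have mB : MeasurableSet (binaryFormDomain p ∩ {r | 1 < ‖r.2.2‖ ∧ ‖r.1.2‖ < ‖r.1.1‖}) :=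
    hD.inter (hx.inter (measurableSet_lt
      (f := fun r : (ℚ_[p] × ℚ_[p]) × (ℚ_[p] × ℚ_[p]) => ‖r.1.2‖) (g := fun r => ‖r.1.1‖)
      (by fun_prop) (by fun_prop)))
  have mC : MeasurableSet (binaryFormDomain p ∩ {r | ‖r.2.2‖ ≤ 1}) :=
    hD.inter (measurableSet_le (f := fun r : (ℚ_[p] × ℚ_[p]) × (ℚ_[p] × ℚ_[p]) => ‖r.2.2‖)
      (g := fun _ => 1) (by fun_prop) (by fun_prop))
  have hs : binaryFormDomain p =
      binaryFormDomain p ∩ {r | 1 < ‖r.2.2‖ ∧ ‖r.1.1‖ ≤ ‖r.1.2‖} ∪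
      binaryFormDomain p ∩ {r | 1 < ‖r.2.2‖ ∧ ‖r.1.2‖ < ‖r.1.1‖} ∪
      binaryFormDomain p ∩ {r | ‖r.2.2‖ ≤ 1} := by
    ext r
    refine ⟨fun h => ?_, ?_⟩
    · rcases le_or_gt ‖r.2.2‖ 1 with h1 | h1
      · exact Or.inr ⟨h, h1⟩
      rcases le_or_gt ‖r.1.1‖ ‖r.1.2‖ with h2 | h2
      exacts [Or.inl (Or.inl ⟨h, h1, h2⟩), Or.inl (Or.inr ⟨h, h1, h2⟩)]
    · rintro ((h | h) | h) <;> exact h.1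
  have dAB : Disjoint (binaryFormDomain p ∩ {r | 1 < ‖r.2.2‖ ∧ ‖r.1.1‖ ≤ ‖r.1.2‖})
      (binaryFormDomain p ∩ {r | 1 < ‖r.2.2‖ ∧ ‖r.1.2‖ < ‖r.1.1‖}) := by
    rw [Set.disjoint_left]
    exact fun r h h' => not_lt.2 h.2.2 h'.2.2
  have dC : Disjoint (binaryFormDomain p ∩ {r | 1 < ‖r.2.2‖ ∧ ‖r.1.1‖ ≤ ‖r.1.2‖} ∪
      binaryFormDomain p ∩ {r | 1 < ‖r.2.2‖ ∧ ‖r.1.2‖ < ‖r.1.1‖})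
      (binaryFormDomain p ∩ {r | ‖r.2.2‖ ≤ 1}) := by
    rw [Set.disjoint_left]
    rintro r (h | h) h' <;> exact not_lt.2 h'.2 h.2.1
  obtain ⟨iA, eA⟩ := binaryForm_large_upper hθ hμ h₂ h₁ mA
  obtain ⟨iB, eB⟩ := binaryForm_large_lower hθ hμ h₂ h₁ mB
  obtain ⟨iC, eC⟩ := binaryForm_small hθ hμ h₂ h₁ mC
  rw [hs]
  refine ⟨(iA.union iB).union iC, ?_⟩
  rw [setIntegral_union dC mC (iA.union iB) iC, setIntegral_union dAB mB iA iB, eA, eB, eC]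
  simp only [Complex.sub_re] at h₁
  have hK := gaussMass_eq hθ hμ (ν₁ := ν₁) (by linarith)
  have hpow : ∀ s t : ℂ, ∀ k : ℕ, s = -(k : ℂ) + t →
      (p : ℂ) ^ s = (p : ℂ)⁻¹ ^ k * (p : ℂ) ^ t := by
    rintro s t k rfl
    rw [Complex.cpow_add _ _ hp, Complex.cpow_neg, Complex.cpow_natCast, inv_pow]
  have hmul : ∀ (k : ℕ) (s : ℂ), (p : ℂ) ^ (k * s) = ((p : ℂ) ^ s) ^ k := fun k s => by
    rw [Complex.cpow_nat_mul]
  have e2 : (p : ℂ) ^ (-1 - 2 * ν₁) = (p : ℂ)⁻¹ * ((p : ℂ) ^ (-ν₁)) ^ 2 := by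
    rw [hpow (-1 - 2 * ν₁) ((2 : ℕ) * -ν₁) 1 (by push_cast; ring), hmul, pow_one]
  have e3 : (p : ℂ) ^ ν₁ = ((p : ℂ) ^ (-ν₁))⁻¹ := by rw [Complex.cpow_neg, inv_inv]
  have e1 : ∀ ν : ℂ, (p : ℂ) ^ (-1 - ν) = (p : ℂ)⁻¹ * (p : ℂ) ^ (-ν) := fun ν => by
    rw [hpow (-1 - ν) (-ν) 1 (by push_cast; ring), pow_one]
  have e4 : (p : ℂ) ^ (-1 - ν₁ - ν₂) * (p : ℂ) ^ (-1 - ν₁ + ν₂) =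
      (p : ℂ)⁻¹ ^ 2 * ((p : ℂ) ^ (-ν₁)) ^ 2 := by
    rw [← Complex.cpow_add _ _ hp,
      hpow (-1 - ν₁ - ν₂ + (-1 - ν₁ + ν₂)) ((2 : ℕ) * -ν₁) 2 (by push_cast; ring), hmul]
  have e5 : (p : ℂ) ^ (-2 - ν₁ - ν₂) = (p : ℂ)⁻¹ ^ 2 * (p : ℂ) ^ (-ν₁) * (p : ℂ) ^ (-ν₂) := by
    rw [hpow (-2 - ν₁ - ν₂) (-ν₁ + -ν₂) 2 (by push_cast; ring),
      Complex.cpow_add _ _ hp, mul_assoc]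
  have e6 : (p : ℂ) ^ (-2 - 2 * ν₁) = (p : ℂ)⁻¹ ^ 2 * ((p : ℂ) ^ (-ν₁)) ^ 2 := by
    rw [hpow (-2 - 2 * ν₁) ((2 : ℕ) * -ν₁) 2 (by push_cast; ring), hmul]
  have e7 : (p : ℂ) ^ (-2 - 2 * ν₁ - ν₂) =
      (p : ℂ)⁻¹ ^ 2 * ((p : ℂ) ^ (-ν₁)) ^ 2 * (p : ℂ) ^ (-ν₂) := by
    rw [hpow (-2 - 2 * ν₁ - ν₂) ((2 : ℕ) * -ν₁ + -ν₂) 2 (by push_cast; ring),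
      Complex.cpow_add _ _ hp, hmul,
      mul_assoc]
  have e8 : (p : ℂ) ^ (-4 - 3 * ν₁ - ν₂) =
      (p : ℂ)⁻¹ ^ 4 * ((p : ℂ) ^ (-ν₁)) ^ 3 * (p : ℂ) ^ (-ν₂) := by
    rw [hpow (-4 - 3 * ν₁ - ν₂) ((3 : ℕ) * -ν₁ + -ν₂) 4 (by push_cast; ring),
      Complex.cpow_add _ _ hp, hmul,
      mul_assoc]
  rw [e2, e1, e3] at hK
  rw [mul_assoc (1 - (p : ℂ)⁻¹), e4, e5, e6, e7, e8, e2, e1, e1]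
  exact binaryForm_pieces_sum hp hK (by simp [hp])

end Assembly

/-- For `Re(ν₂)` and `Re(ν₁−ν₂)` large enough, with `(a,b,c,x) = q`,
the function `|a+bx|^{−1−ν₁+ν₂}·|ac−b²|^{−1−ν₂}·θ(−x−c)` is absolutely integrable on
`R = {min{v(a),v(b),v(c)} > v(ac−b²), v(a+bx) < v(b+cx)}` and its integral equals
`−(1−p⁻¹)p^{−2−ν₁−ν₂} − (1−p⁻¹)p^{−2−2ν₁} − (1−p⁻¹)p^{−2−2ν₁−ν₂} + p^{−4−3ν₁−ν₂}`. -/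
theorem stmt_15 (p : ℕ) [Fact p.Prime]
    [MeasurableSpace ℚ_[p]] [BorelSpace ℚ_[p]]
    (μ : Measure ℚ_[p]) [SigmaFinite μ]
    (hμ_inv : ∀ a : ℚ_[p], μ.map (a + ·) = μ)
    (hμ_norm : μ {x : ℚ_[p] | ‖x‖ ≤ 1} = 1)
    (θ : ℚ_[p] → ℂ) (hθ_cont : Continuous θ)
    (hθ_add : ∀ a b : ℚ_[p], θ (a + b) = θ a * θ b)
    (hθ_unit : ∀ a : ℚ_[p], ‖θ a‖ = 1)
    (hθ_triv : ∀ a : ℚ_[p], ‖a‖ ≤ 1 → θ a = 1)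
    (hθ_nontriv : ∃ a : ℚ_[p], ‖a‖ ≤ (p : ℝ) ∧ θ a ≠ 1) :
    ∃ T : ℝ, ∀ ν₁ ν₂ : ℂ, T < ν₂.re → T < (ν₁ - ν₂).re →
      IntegrableOn
        (fun q : ℚ_[p] × ℚ_[p] × ℚ_[p] × ℚ_[p] =>
          (‖q.1 + q.2.1 * q.2.2.2‖ : ℂ) ^ (-1 - ν₁ + ν₂) *
            (‖q.1 * q.2.2.1 - q.2.1 ^ 2‖ : ℂ) ^ (-1 - ν₂) * θ (-q.2.2.2 - q.2.2.1))
        {q : ℚ_[p] × ℚ_[p] × ℚ_[p] × ℚ_[p] | Padic.addValuation (q.1 * q.2.2.1 - q.2.1 ^ 2) <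
            min (Padic.addValuation q.1)
              (min (Padic.addValuation q.2.1) (Padic.addValuation q.2.2.1)) ∧
          Padic.addValuation (q.1 + q.2.1 * q.2.2.2) <
            Padic.addValuation (q.2.1 + q.2.2.1 * q.2.2.2)}
        (μ.prod (μ.prod (μ.prod μ))) ∧
      ∫ q in {q : ℚ_[p] × ℚ_[p] × ℚ_[p] × ℚ_[p] | Padic.addValuation (q.1 * q.2.2.1 - q.2.1 ^ 2) <
            min (Padic.addValuation q.1)
              (min (Padic.addValuation q.2.1) (Padic.addValuation q.2.2.1)) ∧
          Padic.addValuation (q.1 + q.2.1 * q.2.2.2) <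
            Padic.addValuation (q.2.1 + q.2.2.1 * q.2.2.2)},
          (‖q.1 + q.2.1 * q.2.2.2‖ : ℂ) ^ (-1 - ν₁ + ν₂) *
            (‖q.1 * q.2.2.1 - q.2.1 ^ 2‖ : ℂ) ^ (-1 - ν₂) * θ (-q.2.2.2 - q.2.2.1)
          ∂(μ.prod (μ.prod (μ.prod μ))) =
        -((1 - (p : ℂ)⁻¹) * (p : ℂ) ^ (-2 - ν₁ - ν₂)) -
          (1 - (p : ℂ)⁻¹) * (p : ℂ) ^ (-2 - 2 * ν₁) -
          (1 - (p : ℂ)⁻¹) * (p : ℂ) ^ (-2 - 2 * ν₁ - ν₂) +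
          (p : ℂ) ^ (-4 - 3 * ν₁ - ν₂) := by
  have hμ := padic_isAddHaar μ hμ_inv hμ_norm
  have hθ : IsUnramifiedCharacter θ := ⟨hθ_cont, hθ_add, hθ_unit, hθ_triv, hθ_nontriv⟩
  refine ⟨1, fun ν₁ ν₂ h₂ h₁ => ?_⟩
  have e := (measurePreserving_prodAssoc μ μ (μ.prod μ)).symm MeasurableEquiv.prodAssoc
  rw [binaryFormDomain_prodAssoc]
  obtain ⟨h, h'⟩ := binaryForm_integral hθ hμ_norm h₂ h₁
  exact ⟨(e.integrableOn_comp_preimage MeasurableEquiv.prodAssoc.symm.measurableEmbedding).2 h,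
    (e.setIntegral_preimage_emb MeasurableEquiv.prodAssoc.symm.measurableEmbedding
      (binaryFormKernel θ ν₁ ν₂) (binaryFormDomain p)).trans h'⟩
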